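/- arXiv:1403.3760 — 5 statements merged into one kernel-verified Lean document; each statement's English description precedes it below -/
import Mathlib

section
/- Proposition 5.2. Let U ⊆ ℝⁿ (n ≥ 1) be a bounded open set and let (u₁, u₂) be a pair of continuous real functions on the closure of U that is a viscosity solution of the system −Δ∞u₁ + u₁ − u₂ = 0, −Δ∞u₂ + u₂ − u₁ = 0 in U. For x₀ ∈ U and r > 0 with B̄(x₀,r) ⊆ U, define a(x₀,r) := (M₁(x₀,r) + M₂(x₀,r) − u₁(x₀) − u₂(x₀))/(2r). Then for each fixed x₀ ∈ U, the function r ↦ a(x₀,r) is nondecreasing on {r > 0 : B̄(x₀,r) ⊆ U}: if 0 < s ≤ r and B̄(x₀,r) ⊆ U, then a(x₀,s) ≤ a(x₀,r). -/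
open Filter Metric Set Topology

noncomputable def secondDeriv {n : ℕ} (φ : EuclideanSpace ℝ (Fin n) → ℝ)
    (x v : EuclideanSpace ℝ (Fin n)) : ℝ :=
  iteratedFDeriv ℝ 2 φ x ![v, v]

open scoped Classical in
noncomputable def laplInfPlus {n : ℕ} (φ : EuclideanSpace ℝ (Fin n) → ℝ)
    (x : EuclideanSpace ℝ (Fin n)) : ℝ :=
  if gradient φ x = 0 then
    sSup {t : ℝ | ∃ v : EuclideanSpace ℝ (Fin n), ‖v‖ = 1 ∧ t = secondDeriv φ x v}
  else secondDeriv φ x (gradient φ x) / ‖gradient φ x‖ ^ 2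

open scoped Classical in
noncomputable def laplInfMinus {n : ℕ} (φ : EuclideanSpace ℝ (Fin n) → ℝ)
    (x : EuclideanSpace ℝ (Fin n)) : ℝ :=
  if gradient φ x = 0 then
    sInf {t : ℝ | ∃ v : EuclideanSpace ℝ (Fin n), ‖v‖ = 1 ∧ t = secondDeriv φ x v}
  else secondDeriv φ x (gradient φ x) / ‖gradient φ x‖ ^ 2

/-- One half of the subsolution condition: `-Δ∞⁺φ(x₀) + u(x₀) - v(x₀) ≤ 0` at
local maximum points of `u - φ`. -/
def SubPair {n : ℕ} (U : Set (EuclideanSpace ℝ (Fin n)))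
    (u v : EuclideanSpace ℝ (Fin n) → ℝ) : Prop :=
  ∀ φ : EuclideanSpace ℝ (Fin n) → ℝ, ContDiff ℝ 2 φ →
    ∀ x₀ ∈ U, IsLocalMaxOn (fun x => u x - φ x) U x₀ →
      -laplInfPlus φ x₀ + u x₀ - v x₀ ≤ 0

def SuperPair {n : ℕ} (U : Set (EuclideanSpace ℝ (Fin n)))
    (u v : EuclideanSpace ℝ (Fin n) → ℝ) : Prop :=
  ∀ φ : EuclideanSpace ℝ (Fin n) → ℝ, ContDiff ℝ 2 φ →
    ∀ x₀ ∈ U, IsLocalMinOn (fun x => u x - φ x) U x₀ →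
      0 ≤ -laplInfMinus φ x₀ + u x₀ - v x₀

/-- `(u₁, u₂)` is a viscosity subsolution of the system
`-Δ∞u₁ + u₁ - u₂ = 0`, `-Δ∞u₂ + u₂ - u₁ = 0` in `U`. -/
def IsSubsolution {n : ℕ} (U : Set (EuclideanSpace ℝ (Fin n)))
    (u₁ u₂ : EuclideanSpace ℝ (Fin n) → ℝ) : Prop :=
  UpperSemicontinuousOn u₁ U ∧ UpperSemicontinuousOn u₂ U ∧
    SubPair U u₁ u₂ ∧ SubPair U u₂ u₁

/-- `(u₁, u₂)` is a viscosity supersolution of the system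
`-Δ∞u₁ + u₁ - u₂ = 0`, `-Δ∞u₂ + u₂ - u₁ = 0` in `U`. -/
def IsSupersolution {n : ℕ} (U : Set (EuclideanSpace ℝ (Fin n)))
    (u₁ u₂ : EuclideanSpace ℝ (Fin n) → ℝ) : Prop :=
  LowerSemicontinuousOn u₁ U ∧ LowerSemicontinuousOn u₂ U ∧
    SuperPair U u₁ u₂ ∧ SuperPair U u₂ u₁

def IsSolution {n : ℕ} (U : Set (EuclideanSpace ℝ (Fin n)))
    (u₁ u₂ : EuclideanSpace ℝ (Fin n) → ℝ) : Prop :=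
  IsSubsolution U u₁ u₂ ∧ IsSupersolution U u₁ u₂

/-- First component of the generalized cone pair with vertex `x₀`. -/
noncomputable def cone₁ {n : ℕ} (x₀ : EuclideanSpace ℝ (Fin n)) (C₁ C₂ a b : ℝ)
    (x : EuclideanSpace ℝ (Fin n)) : ℝ :=
  C₁ * Real.exp (Real.sqrt 2 * ‖x - x₀‖) + C₂ * Real.exp (-(Real.sqrt 2 * ‖x - x₀‖)) +
    a * ‖x - x₀‖ + b

/-- Second component of the generalized cone pair with vertex `x₀`. -/
noncomputable def cone₂ {n : ℕ} (x₀ : EuclideanSpace ℝ (Fin n)) (C₁ C₂ a b : ℝ)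
    (x : EuclideanSpace ℝ (Fin n)) : ℝ :=
  -C₁ * Real.exp (Real.sqrt 2 * ‖x - x₀‖) - C₂ * Real.exp (-(Real.sqrt 2 * ‖x - x₀‖)) +
    a * ‖x - x₀‖ + b

noncomputable def sphMax {n : ℕ} (u : EuclideanSpace ℝ (Fin n) → ℝ)
    (x₀ : EuclideanSpace ℝ (Fin n)) (r : ℝ) : ℝ :=
  sSup (u '' sphere x₀ r)

noncomputable def sphMin {n : ℕ} (u : EuclideanSpace ℝ (Fin n) → ℝ)
    (x₀ : EuclideanSpace ℝ (Fin n)) (r : ℝ) : ℝ :=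
  sInf (u '' sphere x₀ r)

noncomputable def Splus {n : ℕ} (u : EuclideanSpace ℝ (Fin n) → ℝ)
    (x₀ : EuclideanSpace ℝ (Fin n)) (r : ℝ) : ℝ :=
  (sphMax u x₀ r - u x₀) / r

noncomputable def Sminus {n : ℕ} (u : EuclideanSpace ℝ (Fin n) → ℝ)
    (x₀ : EuclideanSpace ℝ (Fin n)) (r : ℝ) : ℝ :=
  (sphMin u x₀ r - u x₀) / r

section OneDimensional

/-- Testing against the even quartics `β r² + γ r⁴` at local maxima yields the same information as
testing against parabolas. -/
lemma quadratic_test_of_quartic_test {w : ℝ → ℝ} {r₀ F : ℝ} (hr₀ : 0 < r₀)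
    (H : ∀ β γ : ℝ, IsLocalMax (fun r => w r - (β * r ^ 2 + γ * r ^ 4)) r₀ →
      (2 * β + 4 * γ * r₀ ^ 2 ≠ 0 → F ≤ 2 * β + 12 * γ * r₀ ^ 2) ∧
      (2 * β + 4 * γ * r₀ ^ 2 = 0 → F ≤ max (8 * γ * r₀ ^ 2) 0))
    {p X : ℝ} (hmax : ∀ᶠ r in 𝓝 r₀, w r ≤ w r₀ + p * (r - r₀) + X / 2 * (r - r₀) ^ 2) :
    (p ≠ 0 → F ≤ X) ∧ (p = 0 → F ≤ max X 0) := by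
  have key : ∀ Y, X < Y → (p ≠ 0 → F ≤ Y) ∧ (p = 0 → F ≤ max Y 0) := by
    intro Y hY
    obtain ⟨γ, hγ⟩ : ∃ γ : ℝ, 8 * γ * r₀ ^ 2 = Y - p / r₀ :=
      ⟨(Y - p / r₀) / (8 * r₀ ^ 2), by field_simp⟩
    obtain ⟨β, hβ⟩ : ∃ β : ℝ, 2 * β + 4 * γ * r₀ ^ 2 = p / r₀ :=
      ⟨(p / r₀ - 4 * γ * r₀ ^ 2) / 2, by ring⟩
    have hp : p = (2 * β + 4 * γ * r₀ ^ 2) * r₀ := by rw [hβ]; field_simp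
    have hYeq : Y = 2 * β + 12 * γ * r₀ ^ 2 := by linarith
    have hsmall : ∀ᶠ r in 𝓝 r₀,
        0 < (Y - X) / 2 + γ * (4 * r₀ * (r - r₀) + (r - r₀) ^ 2) := by
      have hc : ContinuousAt
          (fun r => (Y - X) / 2 + γ * (4 * r₀ * (r - r₀) + (r - r₀) ^ 2)) r₀ := by fun_prop
      refine hc.eventually_const_lt ?_
      simp only [sub_self]
      linarith
    have hloc : IsLocalMax (fun r => w r - (β * r ^ 2 + γ * r ^ 4)) r₀ := by
      filter_upwards [hmax, hsmall] with r h1 h2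
      have h3 := mul_nonneg (sq_nonneg (r - r₀)) h2.le
      have h4 : β * r ^ 2 + γ * r ^ 4 - (β * r₀ ^ 2 + γ * r₀ ^ 4) =
          p * (r - r₀) + X / 2 * (r - r₀) ^ 2 + (r - r₀) ^ 2 *
            ((Y - X) / 2 + γ * (4 * r₀ * (r - r₀) + (r - r₀) ^ 2)) := by
        rw [hp, hYeq]; ring
      linarith
    obtain ⟨h1, h2⟩ := H β γ hloc
    constructor
    · intro hp0
      have := h1 (by rw [hβ]; positivity)
      linarith
    · intro hp0
      have := h2 (by rw [hβ, hp0, zero_div])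
      rwa [hγ, hp0, zero_div, sub_zero] at this
  constructor
  · exact fun hp => le_of_forall_gt_imp_ge_of_dense fun Y hY => (key Y hY).1 hp
  · intro hp
    refine le_of_forall_gt_imp_ge_of_dense fun Y hY => ?_
    obtain ⟨h1, h2⟩ := max_lt_iff.mp hY
    simpa [max_eq_left h2.le] using (key Y h1).2 hp

/-- The degenerate information available at critical points of the test function can be improved,
by sliding the test parabola sideways. -/
lemma quadratic_test_of_degenerate_test {w f : ℝ → ℝ} {R : ℝ} (hw : Continuous w)
    (hf : Continuous f)
    (H : ∀ r₀ ∈ Ioo 0 R, ∀ p X : ℝ,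
      (∀ᶠ r in 𝓝 r₀, w r ≤ w r₀ + p * (r - r₀) + X / 2 * (r - r₀) ^ 2) →
      (p ≠ 0 → f r₀ ≤ X) ∧ (p = 0 → f r₀ ≤ max X 0))
    {r₀ : ℝ} (hr₀ : r₀ ∈ Ioo 0 R) {p X : ℝ}
    (hmax : ∀ᶠ r in 𝓝 r₀, w r ≤ w r₀ + p * (r - r₀) + X / 2 * (r - r₀) ^ 2) :
    f r₀ ≤ X := by
  by_cases hp : p ≠ 0
  · exact (H r₀ hr₀ p X hmax).1 hp
  push Not at hp
  subst hp
  by_contra! hlt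
  have hX : X < 0 := by
    by_contra! h0
    have := (H r₀ hr₀ 0 X hmax).2 rfl
    rw [max_eq_left h0] at this
    linarith
  obtain ⟨m, hXm, hm⟩ := exists_between (lt_min hlt hX)
  obtain ⟨hmf, hm0⟩ := lt_min_iff.mp hm
  obtain ⟨c, rfl⟩ : ∃ c : ℝ, m = -2 * c := ⟨-m / 2, by ring⟩
  obtain ⟨κ, rfl⟩ : ∃ κ : ℝ, X = -2 * (c + κ) := ⟨-X / 2 - c, by ring⟩
  have hc : 0 < c := by linarith
  have hκ : 0 < κ := by linarith
  have hev := (hmax.and (hf.continuousAt.eventually_const_lt hmf)).and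
    (isOpen_Ioo.mem_nhds hr₀)
  obtain ⟨η, hη, hball⟩ := Metric.nhds_basis_closedBall.eventually_iff.mp hev
  simp only [Real.closedBall_eq_Icc] at hball
  obtain ⟨τ, hτ0, hτ⟩ : ∃ τ : ℝ, 0 < τ ∧ τ < min η (κ * η / (2 * c)) :=
    exists_between (lt_min hη (by positivity))
  obtain ⟨hτη, hτκ⟩ := lt_min_iff.mp hτ
  rw [lt_div_iff₀ (by positivity)] at hτκ
  have hg : Continuous fun r => w r + c * (r - (r₀ + τ)) ^ 2 := by fun_prop
  obtain ⟨t, ht, htmax⟩ := (isCompact_Icc (a := r₀ - η) (b := r₀ + η)).exists_isMaxOn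
    ⟨r₀, by constructor <;> linarith⟩ hg.continuousOn
  have ht₀ : w r₀ + c * (r₀ - (r₀ + τ)) ^ 2 ≤ w t + c * (t - (r₀ + τ)) ^ 2 :=
    htmax (show r₀ ∈ Icc (r₀ - η) (r₀ + η) by constructor <;> linarith)
  obtain ⟨⟨hwt, hft⟩, htR⟩ := hball ht
  have hbd : -(c + κ) * (t - r₀) ^ 2 + c * (t - (r₀ + τ)) ^ 2 ≥ c * τ ^ 2 := by
    nlinarith [hwt, ht₀]
  have hti : t ∈ Ioo (r₀ - η) (r₀ + η) := by
    refine ⟨lt_of_le_of_ne ht.1 ?_, lt_of_le_of_ne ht.2 ?_⟩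
    · rintro rfl
      nlinarith [mul_lt_mul_of_pos_left hτκ hη]
    · rintro rfl
      nlinarith [mul_pos hc (mul_pos hη hτ0), mul_pos hκ (mul_pos hη hη)]
  have htloc : ∀ᶠ r in 𝓝 t,
      w r ≤ w t + (-2 * c * (t - (r₀ + τ))) * (r - t) + (-2 * c) / 2 * (r - t) ^ 2 := by
    filter_upwards [Ioo_mem_nhds hti.1 hti.2] with r hr
    have h : w r + c * (r - (r₀ + τ)) ^ 2 ≤ w t + c * (t - (r₀ + τ)) ^ 2 :=
      htmax (Ioo_subset_Icc_self hr)
    nlinarith [h]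
  by_cases hts : t = r₀ + τ
  · subst hts
    nlinarith [mul_pos hc (mul_pos hτ0 hτ0), mul_pos hκ (mul_pos hτ0 hτ0)]
  · have hne : -2 * c * (t - (r₀ + τ)) ≠ 0 :=
      mul_ne_zero (by linarith) (sub_ne_zero.mpr hts)
    linarith [(H t htR _ _ htloc).1 hne]

lemma eventually_le_second_order {F G : ℝ → ℝ} {r₀ m : ℝ} (hF : ∀ r, HasDerivAt F (G r) r)
    (hG : HasDerivAt G m r₀) {ε : ℝ} (hε : 0 < ε) :
    ∀ᶠ r in 𝓝 r₀, F r ≤ F r₀ + G r₀ * (r - r₀) + (m + ε) / 2 * (r - r₀) ^ 2 := by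
  have hD : ∀ r, HasDerivAt (fun r => F r - G r₀ * (r - r₀) - (m + ε) / 2 * (r - r₀) ^ 2)
      (G r - G r₀ - (m + ε) * (r - r₀)) r := by
    intro r
    have h1 := (hasDerivAt_id r).sub_const r₀
    refine (((hF r).sub (h1.const_mul (G r₀))).sub
      ((h1.pow 2).const_mul ((m + ε) / 2))).congr_deriv ?_
    simp
    ring
  have hderiv := funext fun r => (hD r).deriv
  have hD2 : HasDerivAt (fun r => G r - G r₀ - (m + ε) * (r - r₀)) (-ε) r₀ := by
    have h1 := (hasDerivAt_id r₀).sub_const r₀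
    exact ((hG.sub_const (G r₀)).sub (h1.const_mul (m + ε))).congr_deriv (by ring)
  have hloc := isLocalMax_of_deriv_deriv_neg (x₀ := r₀)
    (f := fun r => F r - G r₀ * (r - r₀) - (m + ε) / 2 * (r - r₀) ^ 2)
    (by rw [hderiv, hD2.deriv]; linarith) (by rw [(hD r₀).deriv]; ring) (hD r₀).continuousAt
  filter_upwards [hloc] with r hr
  simp only [sub_self] at hr
  nlinarith [hr]

/-- If `w'' ≥ F''` on `(0, R)` in the sense of test parabolas, then `w - F` lies below its chord. -/
lemma sub_le_chord_of_quadratic_test {w f F G : ℝ → ℝ} {R : ℝ} (hw : Continuous w)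
    (hF : ∀ r, HasDerivAt F (G r) r) (hG : ∀ r, HasDerivAt G (f r) r)
    (H : ∀ r₀ ∈ Ioo 0 R, ∀ p X : ℝ,
      (∀ᶠ r in 𝓝 r₀, w r ≤ w r₀ + p * (r - r₀) + X / 2 * (r - r₀) ^ 2) → f r₀ ≤ X)
    {s : ℝ} (hs : s ∈ Ioo 0 R) :
    w s - F s ≤ w 0 - F 0 + ((w R - F R) - (w 0 - F 0)) / R * s := by
  have hR : 0 < R := hs.1.trans hs.2
  set a := w 0 - F 0 with ha
  set b := ((w R - F R) - a) / R with hb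
  have hbR : b * R = (w R - F R) - a := by rw [hb]; field_simp
  by_contra! hlt
  obtain ⟨ε, hε, hεlt⟩ : ∃ ε : ℝ, 0 < ε ∧ ε < (w s - F s - (a + b * s)) / (s * (R - s)) :=
    exists_between (div_pos (by linarith) (mul_pos hs.1 (by linarith [hs.2])))
  rw [lt_div_iff₀ (mul_pos hs.1 (by linarith [hs.2]))] at hεlt
  have hFc : Continuous F := continuous_iff_continuousAt.mpr fun r => (hF r).continuousAt
  have hk : Continuous fun r => w r - F r - (a + b * r) - ε * (r * (R - r)) := by fun_prop
  obtain ⟨t, ht, htmax⟩ := (isCompact_Icc (a := 0) (b := R)).exists_isMaxOn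
    ⟨s, Ioo_subset_Icc_self hs⟩ hk.continuousOn
  have hts : w s - F s - (a + b * s) - ε * (s * (R - s)) ≤
      w t - F t - (a + b * t) - ε * (t * (R - t)) := htmax (Ioo_subset_Icc_self hs)
  have hti : t ∈ Ioo 0 R := by
    refine ⟨lt_of_le_of_ne ht.1 ?_, lt_of_le_of_ne ht.2 ?_⟩
    · rintro rfl
      linarith
    · rintro rfl
      linarith
  have hloc : ∀ᶠ r in 𝓝 t, w r ≤ w t + (G t + b + ε * (R - 2 * t)) * (r - t) +
      (f t - ε) / 2 * (r - t) ^ 2 := by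
    filter_upwards [Ioo_mem_nhds hti.1 hti.2, eventually_le_second_order hF (hG t) hε]
      with r hr h2
    have h : w r - F r - (a + b * r) - ε * (r * (R - r)) ≤
      w t - F t - (a + b * t) - ε * (t * (R - t)) := htmax (Ioo_subset_Icc_self hr)
    nlinarith [h, h2]
  linarith [H t hti _ _ hloc]

end OneDimensional

section Radial

variable {n : ℕ} (x₀ : EuclideanSpace ℝ (Fin n)) (β γ : ℝ)

lemma hasFDerivAt_radial_quartic (x : EuclideanSpace ℝ (Fin n)) :
    HasFDerivAt (fun x => β * ‖x - x₀‖ ^ 2 + γ * ‖x - x₀‖ ^ 4)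
      ((2 * β + 4 * γ * ‖x - x₀‖ ^ 2) • innerSL ℝ (x - x₀)) x := by
  have h1 : HasFDerivAt (fun x => ‖x - x₀‖ ^ 2) (2 • innerSL ℝ (x - x₀)) x := by
    simpa using ((hasFDerivAt_id x).sub_const x₀).norm_sq
  have h2 := (h1.const_mul β).add ((h1.pow 2).const_mul γ)
  refine (h2.congr_fderiv ?_).congr_of_eventuallyEq (Eventually.of_forall fun y => ?_)
  · ext v
    simp
    ring
  · simp only [Pi.add_apply]
    ring

lemma gradient_radial_quartic (x : EuclideanSpace ℝ (Fin n)) :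
    gradient (fun x => β * ‖x - x₀‖ ^ 2 + γ * ‖x - x₀‖ ^ 4) x =
      (2 * β + 4 * γ * ‖x - x₀‖ ^ 2) • (x - x₀) := by
  refine HasGradientAt.gradient ?_
  rw [hasGradientAt_iff_hasFDerivAt]
  refine (hasFDerivAt_radial_quartic x₀ β γ x).congr_fderiv ?_
  ext v
  simp

lemma secondDeriv_radial_quartic (x v : EuclideanSpace ℝ (Fin n)) :
    secondDeriv (fun x => β * ‖x - x₀‖ ^ 2 + γ * ‖x - x₀‖ ^ 4) x v =
      (2 * β + 4 * γ * ‖x - x₀‖ ^ 2) * ‖v‖ ^ 2 + 8 * γ * inner ℝ (x - x₀) v ^ 2 := by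
  have h1 : HasFDerivAt (fun x => ‖x - x₀‖ ^ 2) (2 • innerSL ℝ (x - x₀)) x := by
    simpa using ((hasFDerivAt_id x).sub_const x₀).norm_sq
  have h2 : HasFDerivAt (fun x => innerSL ℝ (x - x₀))
      (innerSL ℝ : EuclideanSpace ℝ (Fin n) →L[ℝ] _) x := by
    exact (innerSL ℝ).hasFDerivAt.comp x ((hasFDerivAt_id x).sub_const x₀)
  have h3 := ((h1.const_mul (4 * γ)).const_add (2 * β)).smul h2
  rw [secondDeriv, iteratedFDeriv_two_apply,
    funext fun y => (hasFDerivAt_radial_quartic x₀ β γ y).fderiv]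
  erw [h3.fderiv]
  have h4 : innerSL ℝ v v = ‖v‖ ^ 2 := real_inner_self_eq_norm_sq v
  have h5 : innerSL ℝ (x - x₀) v = inner ℝ (x - x₀) v := rfl
  simp [-map_sub, h4, h5]
  ring

lemma laplInfPlus_radial_quartic {x : EuclideanSpace ℝ (Fin n)} (hx : x ≠ x₀)
    (h : 2 * β + 4 * γ * ‖x - x₀‖ ^ 2 ≠ 0) :
    laplInfPlus (fun x => β * ‖x - x₀‖ ^ 2 + γ * ‖x - x₀‖ ^ 4) x =
      2 * β + 12 * γ * ‖x - x₀‖ ^ 2 := by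
  have hn : ‖x - x₀‖ ≠ 0 := norm_ne_zero_iff.mpr (sub_ne_zero.mpr hx)
  rw [laplInfPlus, gradient_radial_quartic,
    if_neg (smul_ne_zero h (sub_ne_zero.mpr hx)), secondDeriv_radial_quartic]
  simp only [inner_smul_right, real_inner_self_eq_norm_sq, norm_smul, mul_pow, Real.norm_eq_abs,
    sq_abs]
  generalize ‖x - x₀‖ = ρ at *
  field_simp
  ring

lemma laplInfPlus_radial_quartic_le {x : EuclideanSpace ℝ (Fin n)}
    (h : 2 * β + 4 * γ * ‖x - x₀‖ ^ 2 = 0) :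
    laplInfPlus (fun x => β * ‖x - x₀‖ ^ 2 + γ * ‖x - x₀‖ ^ 4) x ≤
      max (8 * γ * ‖x - x₀‖ ^ 2) 0 := by
  rw [laplInfPlus, gradient_radial_quartic, h, zero_smul, if_pos rfl]
  refine Real.sSup_le ?_ (le_max_right _ _)
  rintro t ⟨v, hv, rfl⟩
  rw [secondDeriv_radial_quartic, h, zero_mul, zero_add]
  have h1 : inner ℝ (x - x₀) v ^ 2 ≤ ‖x - x₀‖ ^ 2 := by
    rw [sq_le_sq, abs_norm]
    simpa [hv] using abs_real_inner_le_norm (x - x₀) v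
  rcases le_total 0 γ with hγ | hγ
  · exact le_max_of_le_left (by gcongr)
  · exact le_max_of_le_right (mul_nonpos_of_nonpos_of_nonneg (by linarith) (sq_nonneg _))

end Radial

section SphereMaximum

variable {n : ℕ} {u v : EuclideanSpace ℝ (Fin n) → ℝ} {x₀ : EuclideanSpace ℝ (Fin n)} {R : ℝ}

lemma sphMax_zero : sphMax u x₀ 0 = u x₀ := by
  simp [sphMax]

lemma le_sphMax (hu : ContinuousOn u (closedBall x₀ R)) {x : EuclideanSpace ℝ (Fin n)}
    (hx : ‖x - x₀‖ ≤ R) : u x ≤ sphMax u x₀ ‖x - x₀‖ := by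
  have hsub : sphere x₀ ‖x - x₀‖ ⊆ closedBall x₀ R :=
    sphere_subset_closedBall.trans (closedBall_subset_closedBall hx)
  exact le_csSup ((isCompact_sphere _ _).bddAbove_image (hu.mono hsub))
    ⟨x, by simp, rfl⟩

lemma exists_eq_sphMax (hn : 1 ≤ n) (hu : ContinuousOn u (closedBall x₀ R)) {r : ℝ}
    (hr : r ∈ Icc 0 R) : ∃ x, ‖x - x₀‖ = r ∧ u x = sphMax u x₀ r := by
  have : Nonempty (Fin n) := ⟨⟨0, hn⟩⟩
  have hsub : sphere x₀ r ⊆ closedBall x₀ R :=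
    sphere_subset_closedBall.trans (closedBall_subset_closedBall hr.2)
  obtain ⟨x, hx, hxs⟩ := (isCompact_sphere x₀ r).exists_sSup_image_eq
    (NormedSpace.sphere_nonempty.mpr hr.1) (hu.mono hsub)
  exact ⟨x, by simpa [dist_eq_norm] using hx, hxs.symm⟩

lemma sphere_eq_image_unit_sphere (hn : 1 ≤ n) {r : ℝ} (hr : 0 ≤ r) :
    sphere x₀ r = (fun e => x₀ + r • e) '' sphere (0 : EuclideanSpace ℝ (Fin n)) 1 := by
  have : Nonempty (Fin n) := ⟨⟨0, hn⟩⟩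
  ext x
  simp only [mem_sphere_iff_norm, sub_zero, mem_image]
  constructor
  · intro hx
    rcases hr.eq_or_lt with rfl | hr
    · obtain ⟨e, he⟩ := NormedSpace.sphere_nonempty (x := (0 : EuclideanSpace ℝ (Fin n)))
        (r := 1) |>.mpr zero_le_one
      exact ⟨e, by simpa using he, by simpa [sub_eq_zero, eq_comm (a := x₀)] using hx⟩
    · refine ⟨r⁻¹ • (x - x₀), ?_, ?_⟩
      · rw [norm_smul, hx, Real.norm_of_nonneg (by positivity), inv_mul_cancel₀ hr.ne']
      · simp [smul_smul, hr.ne']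
  · rintro ⟨e, he, rfl⟩
    simp [norm_smul, he, abs_of_nonneg hr]

lemma continuous_sphMax_projIcc (hn : 1 ≤ n) (hR : 0 ≤ R)
    (hu : ContinuousOn u (closedBall x₀ R)) :
    Continuous fun r => sphMax u x₀ (projIcc 0 R hR r) := by
  have hcont : Continuous ↿fun (r : ℝ) (e : sphere (0 : EuclideanSpace ℝ (Fin n)) 1) =>
      u (x₀ + (projIcc 0 R hR r : ℝ) • (e : EuclideanSpace ℝ (Fin n))) := by
    refine hu.comp_continuous (f := fun q : ℝ × sphere (0 : EuclideanSpace ℝ (Fin n)) 1 =>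
      x₀ + (projIcc 0 R hR q.1 : ℝ) • (q.2 : EuclideanSpace ℝ (Fin n))) ?_ ?_
    · have := continuous_projIcc (h := hR)
      fun_prop
    · rintro ⟨r, e⟩
      have he : ‖(e : EuclideanSpace ℝ (Fin n))‖ = 1 := by simp
      have hr := (projIcc 0 R hR r).2
      simpa [norm_smul, he, abs_of_nonneg hr.1] using hr.2
  have h := isCompact_univ.continuous_sSup hcont
  convert h using 2 with r
  rw [sphMax, sphere_eq_image_unit_sphere hn (projIcc 0 R hR r).2.1, image_image, image_univ,
    image_eq_range]

/-- The spherical maxima of a subsolution satisfy `M_u'' ≥ M_u - M_v` against test parabolas. -/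
lemma sphMax_sub_le_of_quadratic_test (hn : 1 ≤ n) {U : Set (EuclideanSpace ℝ (Fin n))}
    (hsub : SubPair U u v) (hU : closedBall x₀ R ⊆ U) (hR : 0 ≤ R)
    (hu : ContinuousOn u (closedBall x₀ R)) (hv : ContinuousOn v (closedBall x₀ R))
    {r₀ : ℝ} (hr₀ : r₀ ∈ Ioo 0 R) {p X : ℝ}
    (hmax : ∀ᶠ r in 𝓝 r₀, sphMax u x₀ (projIcc 0 R hR r) ≤
      sphMax u x₀ (projIcc 0 R hR r₀) + p * (r - r₀) + X / 2 * (r - r₀) ^ 2) :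
    sphMax u x₀ (projIcc 0 R hR r₀) - sphMax v x₀ (projIcc 0 R hR r₀) ≤ X := by
  have hu' := continuous_sphMax_projIcc hn hR hu
  have hv' := continuous_sphMax_projIcc hn hR hv
  refine quadratic_test_of_degenerate_test (R := R) hu' (hu'.sub hv')
    (fun r₁ hr₁ p X hm => quadratic_test_of_quartic_test hr₁.1 (fun β γ hloc => ?_) hm) hr₀ hmax
  have hproj : ∀ r ∈ Icc 0 R, (projIcc 0 R hR r : ℝ) = r := fun r hr => by
    rw [projIcc_of_mem hR hr]
  obtain ⟨x, hx, hxu⟩ := exists_eq_sphMax hn hu (Ioo_subset_Icc_self hr₁)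
  have hxR : ‖x - x₀‖ < R := hx ▸ hr₁.2
  have hnorm : ContinuousAt (fun y => ‖y - x₀‖) x := by fun_prop
  have hphi : ContDiff ℝ 2
      (fun y : EuclideanSpace ℝ (Fin n) => β * ‖y - x₀‖ ^ 2 + γ * ‖y - x₀‖ ^ 4) := by
    have h1 : ContDiff ℝ 2 (fun y : EuclideanSpace ℝ (Fin n) => ‖y - x₀‖ ^ 2) :=
      (contDiff_id.sub contDiff_const).norm_sq ℝ
    simpa only [← pow_mul] using
      (contDiff_const (c := β)).mul h1 |>.add ((contDiff_const (c := γ)).mul (h1.pow 2))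
  have hxmax : IsLocalMax (fun y => u y - (β * ‖y - x₀‖ ^ 2 + γ * ‖y - x₀‖ ^ 4)) x := by
    have hloc' := hnorm.eventually (hx.symm ▸ hloc)
    filter_upwards [hloc', hnorm.eventually_lt_const hxR] with y hy hyR
    simp only [hx, hproj _ ⟨norm_nonneg (y - x₀), hyR.le⟩,
      hproj _ (Ioo_subset_Icc_self hr₁)] at hy ⊢
    have := le_sphMax hu hyR.le
    linarith
  have hvis := hsub _ hphi x (hU (by simpa [dist_eq_norm] using hxR.le)) (hxmax.on U)
  have hvx : v x ≤ sphMax v x₀ r₁ := hx ▸ le_sphMax hv hxR.le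
  simp only [Pi.sub_apply, hproj _ (Ioo_subset_Icc_self hr₁), ← hxu]
  have hxx : x ≠ x₀ := by
    rintro rfl
    simp only [sub_self, norm_zero] at hx
    exact hr₁.1.ne hx
  rw [← hx] at hvx ⊢
  constructor
  · intro h
    rw [laplInfPlus_radial_quartic x₀ β γ hxx h] at hvis
    linarith
  · intro h
    linarith [laplInfPlus_radial_quartic_le x₀ β γ h]

end SphereMaximum

/-- Proposition 5.2: `r ↦ a(x₀, r)` is nondecreasing, where
`a(x₀,r) = (M₁(x₀,r) + M₂(x₀,r) − u₁(x₀) − u₂(x₀))/(2r)`. -/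
theorem slope_sum_nondecreasing {n : ℕ} (hn : 1 ≤ n)
    {U : Set (EuclideanSpace ℝ (Fin n))} (hUo : IsOpen U) (hUb : Bornology.IsBounded U)
    {u₁ u₂ : EuclideanSpace ℝ (Fin n) → ℝ}
    (hu₁ : ContinuousOn u₁ (closure U)) (hu₂ : ContinuousOn u₂ (closure U))
    (hsol : IsSolution U u₁ u₂) :
    ∀ x₀ ∈ U, ∀ s r : ℝ, 0 < s → s ≤ r → closedBall x₀ r ⊆ U →
      (sphMax u₁ x₀ s + sphMax u₂ x₀ s - u₁ x₀ - u₂ x₀) / (2 * s) ≤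
        (sphMax u₁ x₀ r + sphMax u₂ x₀ r - u₁ x₀ - u₂ x₀) / (2 * r) := by
  intro x₀ _ s r hs hsr hball
  rcases hsr.eq_or_lt with rfl | hsr
  · exact le_rfl
  have hr : 0 < r := hs.trans hsr
  have hc₁ : ContinuousOn u₁ (closedBall x₀ r) := hu₁.mono (hball.trans subset_closure)
  have hc₂ : ContinuousOn u₂ (closedBall x₀ r) := hu₂.mono (hball.trans subset_closure)
  have hM₁ := continuous_sphMax_projIcc hn hr.le hc₁
  have hM₂ := continuous_sphMax_projIcc hn hr.le hc₂
  set f : ℝ → ℝ := fun t =>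
    sphMax u₁ x₀ (projIcc 0 r hr.le t) - sphMax u₂ x₀ (projIcc 0 r hr.le t) with hf
  have hfc : Continuous f := hM₁.sub hM₂
  have hG : ∀ t, HasDerivAt (fun t => ∫ y in (0 : ℝ)..t, f y) (f t) t := fun t =>
    hfc.integral_hasStrictDerivAt 0 t |>.hasDerivAt
  have hGc : Continuous fun t => ∫ y in (0 : ℝ)..t, f y :=
    continuous_iff_continuousAt.mpr fun t => (hG t).continuousAt
  have hF : ∀ t, HasDerivAt (fun t => ∫ z in (0 : ℝ)..t, ∫ y in (0 : ℝ)..z, f y)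
      (∫ y in (0 : ℝ)..t, f y) t := fun t => hGc.integral_hasStrictDerivAt 0 t |>.hasDerivAt
  have h₁ := sub_le_chord_of_quadratic_test (R := r) hM₁ hF hG
    (fun r₀ hr₀ p X hm =>
      sphMax_sub_le_of_quadratic_test hn hsol.1.2.2.1 hball hr.le hc₁ hc₂ hr₀ hm) ⟨hs, hsr⟩
  have h₂ := sub_le_chord_of_quadratic_test (R := r) hM₂ (fun t => (hF t).neg)
    (fun t => (hG t).neg)
    (fun r₀ hr₀ p X hm => by
      have := sphMax_sub_le_of_quadratic_test hn hsol.1.2.2.2 hball hr.le hc₂ hc₁ hr₀ hm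
      simpa [hf] using this) ⟨hs, hsr⟩
  have hs' : (projIcc 0 r hr.le s : ℝ) = s := by rw [projIcc_of_mem hr.le ⟨hs.le, hsr.le⟩]
  simp only [hs', projIcc_left, projIcc_right, sphMax_zero, Pi.neg_apply] at h₁ h₂
  rw [div_le_div_iff₀ (by positivity) (by positivity)]
  generalize (∫ z in (0 : ℝ)..s, ∫ y in (0 : ℝ)..z, f y) = A at h₁ h₂
  generalize (∫ z in (0 : ℝ)..r, ∫ y in (0 : ℝ)..z, f y) = B at h₁ h₂
  generalize (∫ z in (0 : ℝ)..0, ∫ y in (0 : ℝ)..z, f y) = C at h₁ h₂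
  have hq : (sphMax u₁ x₀ s + sphMax u₂ x₀ s - u₁ x₀ - u₂ x₀) ≤
      (sphMax u₁ x₀ r + sphMax u₂ x₀ r - u₁ x₀ - u₂ x₀) / r * s := by
    rw [div_eq_mul_inv] at h₁ h₂ ⊢
    linarith
  rw [div_mul_eq_mul_div, le_div_iff₀ hr] at hq
  linarith
end

section
/- Lemma 5.4 (Local Lipschitz continuity). Let U ⊆ ℝⁿ (n ≥ 1) be a bounded open set and let (u₁, u₂) be a pair of continuous real functions on the closure of U that is a viscosity solution of the system −Δ∞u₁ + u₁ − u₂ = 0, −Δ∞u₂ + u₂ − u₁ = 0 in U. Then u₁ and u₂ are locally Lipschitz continuous in U: for every x₀ ∈ U there exist an open neighborhood W ⊆ U of x₀ and a constant L ≥ 0 such that |u_i(x) − u_i(y)| ≤ L|x − y| for all x, y ∈ W and i = 1, 2. -/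
open Filter Metric Set Topology

section RadialFunctions

variable {E : Type*} [NormedAddCommGroup E] [InnerProductSpace ℝ E]

theorem hasFDerivAt_comp_norm_sub_sq {F F₁ : ℝ → ℝ} (hF : ∀ s, HasDerivAt F (F₁ s) s) (y x : E) :
    HasFDerivAt (fun x => F (‖x - y‖ ^ 2)) ((2 * F₁ (‖x - y‖ ^ 2)) • innerSL ℝ (x - y)) x := by
  have h := (hF (‖x - y‖ ^ 2)).comp_hasFDerivAt x (((hasFDerivAt_id x).sub_const y).norm_sq)
  refine h.congr_fderiv ?_
  ext v
  simp
  ring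

theorem iteratedFDeriv_two_comp_norm_sub_sq {F F₁ : ℝ → ℝ} {F₂ : ℝ} {y x : E}
    (hF : ∀ s, HasDerivAt F (F₁ s) s) (hF₁ : HasDerivAt F₁ F₂ (‖x - y‖ ^ 2)) (v : E) :
    iteratedFDeriv ℝ 2 (fun x => F (‖x - y‖ ^ 2)) x ![v, v] =
      2 * F₁ (‖x - y‖ ^ 2) * ‖v‖ ^ 2 + 4 * F₂ * inner ℝ (x - y) v ^ 2 := by
  have h₁ : fderiv ℝ (fun x => F (‖x - y‖ ^ 2)) =
      fun x => (2 * F₁ (‖x - y‖ ^ 2)) • innerSL ℝ (x - y) :=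
    funext fun x => (hasFDerivAt_comp_norm_sub_sq hF y x).fderiv
  have hc := (hF₁.comp_hasFDerivAt x (((hasFDerivAt_id x).sub_const y).norm_sq)).const_mul 2
  have hl : HasFDerivAt (fun x : E => innerSL ℝ (x - y)) (innerSL ℝ : E →L[ℝ] E →L[ℝ] ℝ) x :=
    (innerSL ℝ : E →L[ℝ] E →L[ℝ] ℝ).hasFDerivAt.comp x ((hasFDerivAt_id x).sub_const y)
  have h₂ : HasFDerivAt (fun x => (2 * F₁ (‖x - y‖ ^ 2)) • innerSL ℝ (x - y)) _ x := hc.smul hl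
  have hv : (innerSL ℝ : E →L[ℝ] E →L[ℝ] ℝ) v v = ‖v‖ ^ 2 := real_inner_self_eq_norm_sq v
  rw [iteratedFDeriv_two_apply, h₁, h₂.fderiv]
  simp [hv, inner_sub_left]
  ring

theorem gradient_comp_norm_sub_sq [CompleteSpace E] {F F₁ : ℝ → ℝ}
    (hF : ∀ s, HasDerivAt F (F₁ s) s) (y x : E) :
    gradient (fun x => F (‖x - y‖ ^ 2)) x = (2 * F₁ (‖x - y‖ ^ 2)) • (x - y) := by
  refine HasGradientAt.gradient ?_
  rw [hasGradientAt_iff_hasFDerivAt]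
  refine (hasFDerivAt_comp_norm_sub_sq hF y x).congr_fderiv ?_
  ext v
  simp

end RadialFunctions

theorem laplInfPlus_comp_norm_sub_sq {n : ℕ} {F F₁ : ℝ → ℝ} {F₂ : ℝ}
    {y x : EuclideanSpace ℝ (Fin n)} (hxy : x ≠ y)
    (hF : ∀ s, HasDerivAt F (F₁ s) s) (hF₁ : HasDerivAt F₁ F₂ (‖x - y‖ ^ 2))
    (hne : F₁ (‖x - y‖ ^ 2) ≠ 0) :
    laplInfPlus (fun x => F (‖x - y‖ ^ 2)) x =
      2 * F₁ (‖x - y‖ ^ 2) + 4 * F₂ * ‖x - y‖ ^ 2 := by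
  have hr : ‖x - y‖ ≠ 0 := norm_ne_zero_iff.2 (sub_ne_zero.2 hxy)
  have hg : gradient (fun x => F (‖x - y‖ ^ 2)) x ≠ 0 := by
    rw [gradient_comp_norm_sub_sq hF]
    exact smul_ne_zero (mul_ne_zero two_ne_zero hne) (sub_ne_zero.2 hxy)
  rw [laplInfPlus, if_neg hg, div_eq_iff (pow_ne_zero _ (norm_ne_zero_iff.2 hg)), secondDeriv,
    iteratedFDeriv_two_comp_norm_sub_sq hF hF₁, gradient_comp_norm_sub_sq hF, norm_smul,
    inner_smul_right, real_inner_self_eq_norm_sq, Real.norm_eq_abs, mul_pow, sq_abs]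
  ring

/-- The cubic Taylor polynomial of the square root at `r₀ ^ 2` dominates the square root. -/
theorem le_taylor_sqrt {r₀ r : ℝ} (hr₀ : 0 < r₀) (hr : 0 ≤ r) :
    r ≤ r₀ + (r ^ 2 - r₀ ^ 2) / (2 * r₀) - (r ^ 2 - r₀ ^ 2) ^ 2 / (8 * r₀ ^ 3) +
      (r ^ 2 - r₀ ^ 2) ^ 3 / (16 * r₀ ^ 5) := by
  have h : r₀ + (r ^ 2 - r₀ ^ 2) / (2 * r₀) - (r ^ 2 - r₀ ^ 2) ^ 2 / (8 * r₀ ^ 3) +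
      (r ^ 2 - r₀ ^ 2) ^ 3 / (16 * r₀ ^ 5) - r =
      (r - r₀) ^ 4 * (r ^ 2 + 4 * r₀ * r + 5 * r₀ ^ 2) / (16 * r₀ ^ 5) := by
    field_simp
    ring
  have : 0 ≤ (r - r₀) ^ 4 * (r ^ 2 + 4 * r₀ * r + 5 * r₀ ^ 2) / (16 * r₀ ^ 5) := by positivity
  linarith

/-- A subsolution minus a concave parabolic cone has no local maximum away from the vertex. -/
theorem SubPair.not_isLocalMax_sub_cone {n : ℕ} {U : Set (EuclideanSpace ℝ (Fin n))}
    {u v : EuclideanSpace ℝ (Fin n) → ℝ} (hsub : SubPair U u v) {A B : ℝ} (hB : 0 ≤ B)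
    {y z : EuclideanSpace ℝ (Fin n)} (hz : z ∈ U) (hzy : z ≠ y)
    (hA : 2 * B * ‖z - y‖ < A) (hv : v z - u z < 2 * B) :
    ¬ IsLocalMax (fun x => u x - (A * ‖x - y‖ - B * ‖x - y‖ ^ 2)) z := by
  intro hmax
  set r₀ := ‖z - y‖ with hr₀_def
  have hr₀ : 0 < r₀ := norm_pos_iff.2 (sub_ne_zero.2 hzy)
  have hA0 : 0 ≤ A := (by positivity : 0 ≤ 2 * B * r₀).trans hA.le
  let F : ℝ → ℝ := fun s => A * (r₀ + (s - r₀ ^ 2) / (2 * r₀) - (s - r₀ ^ 2) ^ 2 / (8 * r₀ ^ 3) +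
      (s - r₀ ^ 2) ^ 3 / (16 * r₀ ^ 5)) - B * s
  let F₁ : ℝ → ℝ := fun s => A * (1 / (2 * r₀) - 2 * (s - r₀ ^ 2) / (8 * r₀ ^ 3) +
      3 * (s - r₀ ^ 2) ^ 2 / (16 * r₀ ^ 5)) - B
  have hF : ∀ s, HasDerivAt F (F₁ s) s := by
    intro s
    have hq : HasDerivAt (fun s : ℝ => s - r₀ ^ 2) 1 s := (hasDerivAt_id s).sub_const _
    have h := (((((hq.div_const (2 * r₀)).const_add r₀).sub
      ((hq.pow 2).div_const (8 * r₀ ^ 3))).add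
      ((hq.pow 3).div_const (16 * r₀ ^ 5))).const_mul A).sub ((hasDerivAt_id s).const_mul B)
    refine h.congr_deriv ?_
    simp [F₁]
  have hF₁ : HasDerivAt F₁ (-(A / (4 * r₀ ^ 3))) (r₀ ^ 2) := by
    have hq : HasDerivAt (fun s : ℝ => s - r₀ ^ 2) 1 (r₀ ^ 2) := (hasDerivAt_id _).sub_const _
    have h := (((((hq.const_mul 2).div_const (8 * r₀ ^ 3)).const_sub (1 / (2 * r₀))).add
      (((hq.pow 2).const_mul 3).div_const (16 * r₀ ^ 5))).const_mul A).sub_const B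
    refine h.congr_deriv ?_
    simp
    field_simp
    ring
  have hF₁val : F₁ (r₀ ^ 2) = A / (2 * r₀) - B := by
    simp [F₁]
    ring
  have hne : F₁ (r₀ ^ 2) ≠ 0 := by
    rw [hF₁val]
    have : B < A / (2 * r₀) := by
      rw [lt_div_iff₀ (by positivity)]
      linarith
    linarith
  have hsmooth : ContDiff ℝ 2 (fun x => F (‖x - y‖ ^ 2)) := by
    have hn : ContDiff ℝ 2 (fun x : EuclideanSpace ℝ (Fin n) => ‖x - y‖ ^ 2) :=
      (contDiff_id.sub contDiff_const).norm_sq ℝ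
    have hF2 : ContDiff ℝ 2 F := by
      simp only [F]
      fun_prop
    exact hF2.comp hn
  have hFz : F (r₀ ^ 2) = A * r₀ - B * r₀ ^ 2 := by simp [F]
  have hlocal : IsLocalMaxOn (fun x => u x - F (‖x - y‖ ^ 2)) U z := by
    refine IsLocalMax.on ?_ U
    filter_upwards [hmax] with x hx
    have h := mul_le_mul_of_nonneg_left (le_taylor_sqrt hr₀ (norm_nonneg (x - y))) hA0
    simp only [← hr₀_def, hFz] at hx ⊢
    simp only [F]
    linarith
  have key := hsub _ hsmooth z hz hlocal
  rw [laplInfPlus_comp_norm_sub_sq hzy hF hF₁ hne, ← hr₀_def, hF₁val] at key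
  have : 2 * (A / (2 * r₀) - B) + 4 * -(A / (4 * r₀ ^ 3)) * r₀ ^ 2 = -(2 * B) := by
    field_simp
    ring
  linarith

theorem SubPair.le_add_mul_norm_sub {n : ℕ} {U : Set (EuclideanSpace ℝ (Fin n))}
    {u v : EuclideanSpace ℝ (Fin n) → ℝ} (hsub : SubPair U u v) {M R : ℝ} (hM : 0 ≤ M)
    (hR : 0 < R) {y : EuclideanSpace ℝ (Fin n)} (hU : closedBall y R ⊆ U)
    (hu : ContinuousOn u (closedBall y R)) (huM : ∀ x ∈ closedBall y R, |u x| ≤ M)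
    (hvM : ∀ x ∈ closedBall y R, |v x| ≤ M) {x : EuclideanSpace ℝ (Fin n)}
    (hx : x ∈ closedBall y R) :
    u x ≤ u y + (2 * M / R + 2 * (M + 1) * R + 1) * ‖x - y‖ := by
  set A := 2 * M / R + 2 * (M + 1) * R + 1 with hA
  have hAR : 2 * (M + 1) * R < A := by
    have : 0 ≤ 2 * M / R := by positivity
    linarith
  have hy : y ∈ closedBall y R := mem_closedBall_self hR.le
  have hcont : ContinuousOn (fun x => u x - (A * ‖x - y‖ - (M + 1) * ‖x - y‖ ^ 2))
      (closedBall y R) :=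
    hu.sub (by fun_prop)
  obtain ⟨z, hz, hzmax⟩ := (isCompact_closedBall y R).exists_isMaxOn ⟨y, hy⟩ hcont
  have hbound : u z - (A * ‖z - y‖ - (M + 1) * ‖z - y‖ ^ 2) ≤ u y := by
    by_cases hzy : z = y
    · simp [hzy]
    have hzR : ‖z - y‖ ≤ R := mem_closedBall_iff_norm.1 hz
    have huz := abs_le.1 (huM z hz)
    have hvz := abs_le.1 (hvM z hz)
    have huy := abs_le.1 (huM y hy)
    rcases hzR.lt_or_eq with hlt | heq
    · refine (hsub.not_isLocalMax_sub_cone (by linarith : 0 ≤ M + 1) (hU hz) hzy ?_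
        (by linarith) (hzmax.isLocalMax ?_)).elim
      · exact (mul_le_mul_of_nonneg_left hzR (by linarith)).trans_lt hAR
      · exact closedBall_mem_nhds_of_mem (mem_ball_iff_norm.2 hlt)
    · have hRR : A * R = 2 * M + 2 * (M + 1) * R ^ 2 + R := by
        rw [hA]
        field_simp
      have : 0 ≤ (M + 1) * R ^ 2 := by positivity
      rw [heq, hRR]
      linarith
  have hxz : u x - (A * ‖x - y‖ - (M + 1) * ‖x - y‖ ^ 2) ≤ _ := hzmax hx
  have : 0 ≤ (M + 1) * ‖x - y‖ ^ 2 := by positivity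
  linarith

/-- Lemma 5.4: local Lipschitz continuity of viscosity solutions. -/
theorem solution_locallyLipschitz {n : ℕ} (hn : 1 ≤ n)
    {U : Set (EuclideanSpace ℝ (Fin n))} (hUo : IsOpen U) (hUb : Bornology.IsBounded U)
    {u₁ u₂ : EuclideanSpace ℝ (Fin n) → ℝ}
    (hu₁ : ContinuousOn u₁ (closure U)) (hu₂ : ContinuousOn u₂ (closure U))
    (hsol : IsSolution U u₁ u₂) :
    ∀ x₀ ∈ U, ∃ W : Set (EuclideanSpace ℝ (Fin n)), IsOpen W ∧ x₀ ∈ W ∧ W ⊆ U ∧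
      ∃ L : ℝ, 0 ≤ L ∧ ∀ x ∈ W, ∀ y ∈ W,
        |u₁ x - u₁ y| ≤ L * ‖x - y‖ ∧ |u₂ x - u₂ y| ≤ L * ‖x - y‖ := by
  intro x₀ hx₀
  obtain ⟨ε, hε, hεU⟩ := Metric.nhds_basis_closedBall.mem_iff.1 (hUo.mem_nhds hx₀)
  set K := closedBall x₀ ε
  have hc₁ : ContinuousOn u₁ K := hu₁.mono (hεU.trans subset_closure)
  have hc₂ : ContinuousOn u₂ K := hu₂.mono (hεU.trans subset_closure)
  obtain ⟨M₁, hM₁⟩ := (isCompact_closedBall x₀ ε).exists_bound_of_continuousOn hc₁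
  obtain ⟨M₂, hM₂⟩ := (isCompact_closedBall x₀ ε).exists_bound_of_continuousOn hc₂
  have hxK : x₀ ∈ K := mem_closedBall_self hε.le
  set M := max M₁ M₂
  have hM : 0 ≤ M := (norm_nonneg _).trans ((hM₁ x₀ hxK).trans (le_max_left _ _))
  have hb₁ : ∀ x ∈ K, |u₁ x| ≤ M := fun x hx => (hM₁ x hx).trans (le_max_left _ _)
  have hb₂ : ∀ x ∈ K, |u₂ x| ≤ M := fun x hx => (hM₂ x hx).trans (le_max_right _ _)
  set R := 2 * ε / 3 with hR_def
  have hR : 0 < R := by positivity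
  obtain ⟨⟨-, -, hs₁, hs₂⟩, -⟩ := hsol
  have hball : ∀ y ∈ ball x₀ (ε / 3), closedBall y R ⊆ K := fun y hy =>
    closedBall_subset_closedBall' (by linarith [mem_ball.1 hy])
  have hmem : ∀ x ∈ ball x₀ (ε / 3), ∀ y ∈ ball x₀ (ε / 3), x ∈ closedBall y R := by
    intro x hx y hy
    have := dist_triangle_right x y x₀
    rw [mem_closedBall]
    linarith [mem_ball.1 hx, mem_ball.1 hy]
  have hone : ∀ {u v : EuclideanSpace ℝ (Fin n) → ℝ}, SubPair U u v → ContinuousOn u K →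
      (∀ x ∈ K, |u x| ≤ M) → (∀ x ∈ K, |v x| ≤ M) →
      ∀ x ∈ ball x₀ (ε / 3), ∀ y ∈ ball x₀ (ε / 3),
        |u x - u y| ≤ (2 * M / R + 2 * (M + 1) * R + 1) * ‖x - y‖ := by
    intro u v hs hc hu hv x hx y hy
    have h : ∀ x ∈ ball x₀ (ε / 3), ∀ y ∈ ball x₀ (ε / 3),
        u x ≤ u y + (2 * M / R + 2 * (M + 1) * R + 1) * ‖x - y‖ := fun x hx y hy =>
      hs.le_add_mul_norm_sub hM hR ((hball y hy).trans hεU) (hc.mono (hball y hy))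
        (fun w hw => hu w (hball y hy hw)) (fun w hw => hv w (hball y hy hw)) (hmem x hx y hy)
    have hxy := h x hx y hy
    have hyx := h y hy x hx
    rw [norm_sub_rev] at hyx
    rw [abs_le]
    constructor <;> linarith
  refine ⟨ball x₀ (ε / 3), isOpen_ball, mem_ball_self (by positivity),
    (ball_subset_closedBall.trans (closedBall_subset_closedBall (by linarith))).trans hεU,
    2 * M / R + 2 * (M + 1) * R + 1, by positivity, fun x hx y hy =>
      ⟨hone hs₁ hc₁ hb₁ hb₂ x hx y hy, hone hs₂ hc₂ hb₂ hb₁ x hx y hy⟩⟩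
end

section
/- Lemma 5.6(ii). Let U ⊆ ℝⁿ (n ≥ 1) be a bounded open set and let (u₁, u₂) be a pair of continuous real functions on the closure of U that is a viscosity solution of the system −Δ∞u₁ + u₁ − u₂ = 0, −Δ∞u₂ + u₂ − u₁ = 0 in U. Then for every y ∈ U and every i ∈ {1,2}, the limits S_i⁺(y) := lim_{r→0⁺} S_i⁺(y,r) and S_i⁻(y) := lim_{r→0⁺} S_i⁻(y,r) exist, are finite, and satisfy S_i⁺(y) = −S_i⁻(y). -/
open Filter Metric Set Topology

/-- `-Δ∞u ≤ K` in `U` in the viscosity sense. -/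
def InfLaplGE {n : ℕ} (U : Set (EuclideanSpace ℝ (Fin n)))
    (u : EuclideanSpace ℝ (Fin n) → ℝ) (K : ℝ) : Prop :=
  ∀ φ : EuclideanSpace ℝ (Fin n) → ℝ, ContDiff ℝ 2 φ →
    ∀ x₀ ∈ U, IsLocalMaxOn (fun x => u x - φ x) U x₀ → -K ≤ laplInfPlus φ x₀

section Radial

variable {n : ℕ} {F F' F'' : ℝ → ℝ}

theorem hasFDerivAt_radial (hF : ∀ t, HasDerivAt F (F' t) t) (y x : EuclideanSpace ℝ (Fin n)) :
    HasFDerivAt (fun x => F (‖x - y‖ ^ 2)) ((2 * F' (‖x - y‖ ^ 2)) • innerSL ℝ (x - y)) x := by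
  have h1 : HasFDerivAt (fun x : EuclideanSpace ℝ (Fin n) => ‖x - y‖ ^ 2)
      (2 • innerSL ℝ (x - y)) x := by
    simpa using ((hasFDerivAt_id x).sub_const y).norm_sq
  refine ((hF _).comp_hasFDerivAt x h1).congr_fderiv ?_
  ext v
  simp
  ring

theorem gradient_radial (hF : ∀ t, HasDerivAt F (F' t) t) (y x : EuclideanSpace ℝ (Fin n)) :
    gradient (fun x => F (‖x - y‖ ^ 2)) x = (2 * F' (‖x - y‖ ^ 2)) • (x - y) := by
  apply HasGradientAt.gradient
  rw [hasGradientAt_iff_hasFDerivAt]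
  refine (hasFDerivAt_radial hF y x).congr_fderiv ?_
  ext v
  simp

theorem secondDeriv_radial (hF : ∀ t, HasDerivAt F (F' t) t) (hF' : ∀ t, HasDerivAt F' (F'' t) t)
    (y x v : EuclideanSpace ℝ (Fin n)) :
    secondDeriv (fun x => F (‖x - y‖ ^ 2)) x v =
      4 * F'' (‖x - y‖ ^ 2) * inner ℝ (x - y) v ^ 2 + 2 * F' (‖x - y‖ ^ 2) * ‖v‖ ^ 2 := by
  have h1 : fderiv ℝ (fun x : EuclideanSpace ℝ (Fin n) => F (‖x - y‖ ^ 2)) =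
      fun x => (2 * F' (‖x - y‖ ^ 2)) • innerSL ℝ (x - y) :=
    funext fun x => (hasFDerivAt_radial hF y x).fderiv
  have h2 : HasFDerivAt
      (fun x : EuclideanSpace ℝ (Fin n) => (2 * F' (‖x - y‖ ^ 2)) • innerSL ℝ (x - y)) _ x :=
    ((hasFDerivAt_radial hF' y x).const_mul 2).smul
      ((innerSL ℝ).hasFDerivAt.comp x ((hasFDerivAt_id x).sub_const y))
  rw [secondDeriv, iteratedFDeriv_two_apply, h1, h2.fderiv]
  have h3 : (innerSL ℝ) v v = ‖v‖ ^ 2 := by rw [innerSL_apply_apply, real_inner_self_eq_norm_sq]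
  simp [h3, inner_sub_left]
  ring

theorem laplInfPlus_radial (hF : ∀ t, HasDerivAt F (F' t) t)
    (hF' : ∀ t, HasDerivAt F' (F'' t) t) {y x : EuclideanSpace ℝ (Fin n)} (hx : x ≠ y)
    (h0 : F' (‖x - y‖ ^ 2) ≠ 0) :
    laplInfPlus (fun x => F (‖x - y‖ ^ 2)) x =
      4 * F'' (‖x - y‖ ^ 2) * ‖x - y‖ ^ 2 + 2 * F' (‖x - y‖ ^ 2) := by
  have hx' : x - y ≠ 0 := sub_ne_zero.2 hx
  have hn : ‖x - y‖ ≠ 0 := norm_ne_zero_iff.2 hx'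
  rw [laplInfPlus, gradient_radial hF, if_neg (by simp [h0, hx']), secondDeriv_radial hF hF',
    inner_smul_right, real_inner_self_eq_norm_sq, norm_smul, mul_pow ‖_‖ ‖_‖, Real.norm_eq_abs, sq_abs]
  field_simp

theorem laplInfPlus_neg_quadratic (hn : 1 ≤ n) {C : ℝ} (hC : 0 < C)
    (y x : EuclideanSpace ℝ (Fin n)) :
    laplInfPlus (fun x => -(C / 2) * ‖x - y‖ ^ 2) x = -C := by
  have hF : ∀ t : ℝ, HasDerivAt (fun t => -(C / 2) * t) (-(C / 2)) t := fun t => by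
    simpa using (hasDerivAt_id t).const_mul (-(C / 2))
  have hF' : ∀ t : ℝ, HasDerivAt (fun _ : ℝ => -(C / 2)) 0 t := fun t => hasDerivAt_const _ _
  by_cases hx : x = y
  · have : Nonempty (Fin n) := ⟨⟨0, hn⟩⟩
    obtain ⟨e, he⟩ := (NormedSpace.sphere_nonempty (E := EuclideanSpace ℝ (Fin n)) (x := 0)).2
      (zero_le_one (α := ℝ))
    rw [laplInfPlus, gradient_radial hF, if_pos (by simp [hx])]
    have : {t : ℝ | ∃ v : EuclideanSpace ℝ (Fin n), ‖v‖ = 1 ∧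
        t = secondDeriv (fun x => -(C / 2) * ‖x - y‖ ^ 2) x v} = {-C} := by
      ext t
      simp only [mem_ofPred_eq, mem_singleton_iff, secondDeriv_radial hF hF']
      constructor
      · rintro ⟨v, hv, rfl⟩
        rw [hv]
        ring
      · rintro rfl
        refine ⟨e, by simpa using he, ?_⟩
        rw [mem_sphere_zero_iff_norm.1 he]
        ring
    rw [this, csSup_singleton]
  · rw [laplInfPlus_radial hF hF' hx (by simp [hC.ne'])]
    ring

end Radial

section Comparison

variable {n : ℕ} {U : Set (EuclideanSpace ℝ (Fin n))} {u : EuclideanSpace ℝ (Fin n) → ℝ}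
  {K C a r : ℝ} {y : EuclideanSpace ℝ (Fin n)}

theorem InfLaplGE.exists_mem_sphere_ge (hu : InfLaplGE U u K) (hn : 1 ≤ n)
    (hc : ContinuousOn u U) (hC : 0 < C) (hKC : K < C) (hr : 0 < r) (hU : closedBall y r ⊆ U) :
    ∃ x ∈ sphere y r, u y - C / 2 * r ^ 2 ≤ u x := by
  by_contra! hlt
  obtain ⟨x₀, hx₀, hmax⟩ := (isCompact_closedBall y r).exists_isMaxOn
    ⟨y, mem_closedBall_self hr.le⟩ (f := fun x => u x - -(C / 2) * ‖x - y‖ ^ 2)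
    ((hc.mono hU).sub (by fun_prop))
  have hball : x₀ ∈ ball y r := by
    by_contra hb
    have hs : ‖x₀ - y‖ = r := by
      rw [mem_closedBall_iff_norm] at hx₀
      rw [mem_ball_iff_norm, not_lt] at hb
      exact le_antisymm hx₀ hb
    have h1 := hlt x₀ (mem_sphere_iff_norm.2 hs)
    have h2 := isMaxOn_iff.1 hmax _ (mem_closedBall_self hr.le)
    simp only [hs, sub_self, norm_zero] at h2
    nlinarith
  have hloc : IsLocalMaxOn (fun x => u x - -(C / 2) * ‖x - y‖ ^ 2) U x₀ :=
    (hmax.isLocalMax (closedBall_mem_nhds_of_mem hball)).on U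
  have h := hu (fun x => -(C / 2) * ‖x - y‖ ^ 2)
    (contDiff_const.mul ((contDiff_id.sub contDiff_const).norm_sq ℝ)) x₀ (hU hx₀) hloc
  rw [laplInfPlus_neg_quadratic hn hC] at h
  linarith

/-- The Taylor polynomial of degree three of `t ↦ √t` at `ρ ^ 2` lies above it. -/
theorem le_sqrt_taylor {ρ s : ℝ} (hρ : 0 < ρ) (hs : 0 ≤ s) :
    s ≤ ρ + (s ^ 2 - ρ ^ 2) / (2 * ρ) - (s ^ 2 - ρ ^ 2) ^ 2 / (8 * ρ ^ 3) +
      (s ^ 2 - ρ ^ 2) ^ 3 / (16 * ρ ^ 5) := by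
  have h : ρ + (s ^ 2 - ρ ^ 2) / (2 * ρ) - (s ^ 2 - ρ ^ 2) ^ 2 / (8 * ρ ^ 3) +
      (s ^ 2 - ρ ^ 2) ^ 3 / (16 * ρ ^ 5) - s =
      (s - ρ) ^ 4 * (s ^ 2 + 4 * s * ρ + 5 * ρ ^ 2) / (16 * ρ ^ 5) := by
    field_simp
    ring
  have : 0 ≤ (s - ρ) ^ 4 * (s ^ 2 + 4 * s * ρ + 5 * ρ ^ 2) / (16 * ρ ^ 5) := by positivity
  linarith

theorem InfLaplGE.le_quadratic_cone (hu : InfLaplGE U u K)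
    (hc : ContinuousOn u U) (hC : 0 < C) (hKC : K < C) (hr : 0 < r) (hU : closedBall y r ⊆ U)
    (ha : C * r < a) (hs : ∀ x ∈ sphere y r, u x ≤ u y + a * r - C / 2 * r ^ 2) :
    ∀ x ∈ closedBall y r, u x ≤ u y + a * ‖x - y‖ - C / 2 * ‖x - y‖ ^ 2 := by
  obtain ⟨x₀, hx₀, hmax⟩ := (isCompact_closedBall y r).exists_isMaxOn
    ⟨y, mem_closedBall_self hr.le⟩ (f := fun x => u x - (a * ‖x - y‖ - C / 2 * ‖x - y‖ ^ 2))
    ((hc.mono hU).sub (by fun_prop))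
  by_contra! hlt
  obtain ⟨x, hx, hlt⟩ := hlt
  have hval : u y < u x₀ - (a * ‖x₀ - y‖ - C / 2 * ‖x₀ - y‖ ^ 2) := by
    have h2 := isMaxOn_iff.1 hmax _ hx
    linarith
  have hne : x₀ ≠ y := by
    rintro rfl
    simp at hval
  have hlt' : ‖x₀ - y‖ < r := by
    refine lt_of_le_of_ne (mem_closedBall_iff_norm.1 hx₀) fun h => ?_
    have h1 := hs x₀ (mem_sphere_iff_norm.2 h)
    rw [h] at hval
    linarith
  have hpos : 0 < ‖x₀ - y‖ := norm_pos_iff.2 (sub_ne_zero.2 hne)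
  obtain ⟨ρ, hρ⟩ : ∃ ρ, ρ = ‖x₀ - y‖ := ⟨_, rfl⟩
  rw [← hρ] at hpos hlt'
  have ha0 : 0 < a := (mul_pos hC hr).trans ha
  set F : ℝ → ℝ := fun t => a * (ρ + (t - ρ ^ 2) / (2 * ρ) - (t - ρ ^ 2) ^ 2 / (8 * ρ ^ 3) +
      (t - ρ ^ 2) ^ 3 / (16 * ρ ^ 5)) - C / 2 * t with hFdef
  set F' : ℝ → ℝ := fun t => a * (1 / (2 * ρ) - 2 * (t - ρ ^ 2) / (8 * ρ ^ 3) +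
      3 * (t - ρ ^ 2) ^ 2 / (16 * ρ ^ 5)) - C / 2 with hF'def
  set F'' : ℝ → ℝ := fun t => a * (- 2 / (8 * ρ ^ 3) +
      6 * (t - ρ ^ 2) / (16 * ρ ^ 5)) with hF''def
  have hF : ∀ t, HasDerivAt F (F' t) t := fun t => by
    have h := (hasDerivAt_id t).sub_const (ρ ^ 2)
    refine ((((((h.div_const (2 * ρ)).const_add ρ).sub ((h.pow 2).div_const (8 * ρ ^ 3))).add
      ((h.pow 3).div_const (16 * ρ ^ 5))).const_mul a).sub
      ((hasDerivAt_id t).const_mul (C / 2))).congr_deriv ?_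
    simp [hF'def]
  have hF' : ∀ t, HasDerivAt F' (F'' t) t := fun t => by
    have h := (hasDerivAt_id t).sub_const (ρ ^ 2)
    refine ((((((h.const_mul 2).div_const (8 * ρ ^ 3)).const_sub (1 / (2 * ρ))).add
      (((h.pow 2).const_mul 3).div_const (16 * ρ ^ 5))).const_mul a).sub_const
      (C / 2)).congr_deriv ?_
    simp only [hF''def, id]
    ring
  have hsm : ContDiff ℝ 2 (fun x : EuclideanSpace ℝ (Fin n) => F (‖x - y‖ ^ 2)) := by
    have h1 : ContDiff ℝ 2 F := by fun_prop
    exact h1.comp ((contDiff_id.sub contDiff_const).norm_sq ℝ)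
  have hFle : ∀ x : EuclideanSpace ℝ (Fin n),
      a * ‖x - y‖ - C / 2 * ‖x - y‖ ^ 2 ≤ F (‖x - y‖ ^ 2) := fun x => by
    have := mul_le_mul_of_nonneg_left (le_sqrt_taylor hpos (norm_nonneg (x - y))) ha0.le
    simp only [hFdef]
    linarith
  have hFeq : F (‖x₀ - y‖ ^ 2) = a * ‖x₀ - y‖ - C / 2 * ‖x₀ - y‖ ^ 2 := by
    simp [hFdef, ← hρ]
  have hloc : IsLocalMaxOn (fun x => u x - F (‖x - y‖ ^ 2)) U x₀ := by
    refine IsLocalMax.on ?_ U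
    filter_upwards [closedBall_mem_nhds_of_mem (mem_ball_iff_norm.2 (hρ ▸ hlt'))] with z hz
    have h2 := isMaxOn_iff.1 hmax _ hz
    rw [hFeq]
    linarith [hFle z]
  have hne' : F' (‖x₀ - y‖ ^ 2) ≠ 0 := by
    have : C * ρ < a := (mul_lt_mul_of_pos_left hlt' hC).trans ha
    have h3 : F' (‖x₀ - y‖ ^ 2) = (a - C * ρ) / (2 * ρ) := by
      simp [hF'def, ← hρ]
      field_simp
    rw [h3]
    exact (div_pos (by linarith) (by positivity)).ne'
  have h := hu _ hsm x₀ (hU hx₀) hloc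
  have hval' : 4 * F'' (‖x₀ - y‖ ^ 2) * ‖x₀ - y‖ ^ 2 + 2 * F' (‖x₀ - y‖ ^ 2) = -C := by
    simp [hF'def, hF''def, ← hρ]
    field_simp
    ring
  rw [laplInfPlus_radial hF hF' hne hne', hval'] at h
  linarith

end Comparison

section Slopes

variable {n : ℕ} {U : Set (EuclideanSpace ℝ (Fin n))} {u : EuclideanSpace ℝ (Fin n) → ℝ}
  {K C r s : ℝ} {y : EuclideanSpace ℝ (Fin n)}

theorem exists_mem_sphere_eq_Splus (hn : 1 ≤ n) (hc : ContinuousOn u U) (hr : 0 < r)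
    (hU : closedBall y r ⊆ U) :
    ∃ x ∈ sphere y r, u x = u y + Splus u y r * r ∧
      ∀ z ∈ sphere y r, u z ≤ u y + Splus u y r * r := by
  have : Nonempty (Fin n) := ⟨⟨0, hn⟩⟩
  obtain ⟨x, hx, hxe, hxm⟩ := (isCompact_sphere y r).exists_sSup_image_eq_and_ge
    (NormedSpace.sphere_nonempty.2 hr.le) (hc.mono (sphere_subset_closedBall.trans hU))
  have he : u y + Splus u y r * r = u x := by
    rw [Splus, sphMax, hxe]
    field_simp
    ring
  exact ⟨x, hx, he.symm, fun z hz => he ▸ hxm z hz⟩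

theorem Sminus_eq_neg_Splus_neg (u : EuclideanSpace ℝ (Fin n) → ℝ)
    (y : EuclideanSpace ℝ (Fin n)) (r : ℝ) : Sminus u y r = -Splus (-u) y r := by
  have h : sphMin u y r = -sphMax (-u) y r := by
    rw [sphMin, sphMax, Real.sInf_def, ← Set.image_neg_eq_neg, Set.image_image]
    rfl
  rw [Sminus, Splus, h, Pi.neg_apply]
  ring

theorem InfLaplGE.neg_le_Splus (hu : InfLaplGE U u K) (hn : 1 ≤ n) (hc : ContinuousOn u U)
    (hC : 0 < C) (hKC : K < C) (hr : 0 < r) (hU : closedBall y r ⊆ U) :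
    0 ≤ Splus u y r + C / 2 * r := by
  obtain ⟨x, hx, hle⟩ := hu.exists_mem_sphere_ge hn hc hC hKC hr hU
  obtain ⟨-, -, -, hm⟩ := exists_mem_sphere_eq_Splus hn hc hr hU
  have := hm x hx
  by_contra! h
  nlinarith

theorem InfLaplGE.Splus_add_le (hu : InfLaplGE U u K) (hn : 1 ≤ n) (hc : ContinuousOn u U)
    (hC : 0 < C) (hKC : K < C) (hs : 0 < s) (hsr : s ≤ r) (hU : closedBall y r ⊆ U) :
    Splus u y s + C / 2 * s ≤ max (Splus u y r + C / 2 * r) (2 * C * r) := by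
  have hr : 0 < r := hs.trans_le hsr
  set a := max (Splus u y r + C / 2 * r) (2 * C * r)
  have ha1 : Splus u y r + C / 2 * r ≤ a := le_max_left _ _
  have ha2 : 2 * C * r ≤ a := le_max_right _ _
  have hCr : 0 < C * r := mul_pos hC hr
  obtain ⟨-, -, -, hm⟩ := exists_mem_sphere_eq_Splus hn hc hr hU
  obtain ⟨x, hx, hxe, -⟩ := exists_mem_sphere_eq_Splus hn hc hs
    ((closedBall_subset_closedBall hsr).trans hU)
  have hxn := mem_sphere_iff_norm.1 hx
  have h := hu.le_quadratic_cone hc hC hKC hr hU (a := a) (by linarith)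
    (fun z hz => by nlinarith [hm z hz]) x (mem_closedBall_iff_norm.2 (hxn.trans_le hsr))
  rw [hxn, hxe] at h
  by_contra! hlt
  nlinarith

theorem InfLaplGE.exists_tendsto_Splus (hu : InfLaplGE U u K) (hn : 1 ≤ n) (hUo : IsOpen U)
    (hc : ContinuousOn u U) (hy : y ∈ U) :
    ∃ p, 0 ≤ p ∧ Tendsto (fun r => Splus u y r) (𝓝[>] 0) (𝓝 p) := by
  obtain ⟨R, hR, hRU⟩ := nhds_basis_closedBall.mem_iff.1 (hUo.mem_nhds hy)
  obtain ⟨C, hC, hKC⟩ : ∃ C, 0 < C ∧ K < C := ⟨max K 0 + 1, by positivity, by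
    linarith [le_max_left K 0]⟩
  have hsub : ∀ {r}, r < R → closedBall y r ⊆ U := fun hr =>
    (closedBall_subset_closedBall hr.le).trans hRU
  set h : ℝ → ℝ := fun r => max (Splus u y r + C / 2 * r) (2 * C * r)
  have hmono : MonotoneOn h (Ioo 0 R) := fun s hs r hr hsr =>
    max_le (hu.Splus_add_le hn hc hC hKC hs.1 hsr (hsub hr.2))
      (le_max_of_le_right (by gcongr))
  have hnonneg : ∀ r ∈ Ioo 0 R, 0 ≤ h r := fun r hr =>
    le_max_of_le_left (hu.neg_le_Splus hn hc hC hKC hr.1 (hsub hr.2))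
  have hlim : Tendsto h (𝓝[>] 0) (𝓝 (sInf (h '' Ioo 0 R))) :=
    hmono.tendsto_nhdsWithin_Ioo_right ⟨R / 2, by constructor <;> linarith⟩
      ⟨0, by rintro _ ⟨r, hr, rfl⟩; exact hnonneg r hr⟩
  have hmem : Ioo 0 R ∈ 𝓝[>] (0 : ℝ) := Ioo_mem_nhdsGT hR
  have hlin : ∀ c : ℝ, Tendsto (fun r : ℝ => c * r) (𝓝[>] 0) (𝓝 0) := fun c => by
    have : Tendsto (fun r : ℝ => c * r) (𝓝 0) (𝓝 (c * 0)) := tendsto_id.const_mul c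
    rw [mul_zero] at this
    exact this.mono_left nhdsWithin_le_nhds
  refine ⟨sInf (h '' Ioo 0 R), ge_of_tendsto hlim (by filter_upwards [hmem] using hnonneg), ?_⟩
  refine tendsto_of_tendsto_of_tendsto_of_le_of_le' (g := fun r => h r - (C / 2 + 2 * C) * r)
    (h := fun r => h r - C / 2 * r) (by simpa using hlim.sub (hlin _))
    (by simpa using hlim.sub (hlin _)) ?_ ?_
  · filter_upwards [hmem] with r hr
    have h1 := hu.neg_le_Splus hn hc hC hKC hr.1 (hsub hr.2)
    have h2 : h r ≤ (Splus u y r + C / 2 * r) + 2 * C * r :=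
      max_le (by nlinarith [hr.1]) (by linarith)
    linarith
  · filter_upwards with r
    have : Splus u y r + C / 2 * r ≤ h r := le_max_left _ _
    linarith

theorem InfLaplGE.slope_le_slope_neg (hu' : InfLaplGE U (-u) K) (hn : 1 ≤ n)
    (hUo : IsOpen U) (hc : ContinuousOn u U) (hy : y ∈ U) {p q : ℝ} (hq : 0 ≤ q)
    (hup : Tendsto (fun r => Splus u y r) (𝓝[>] 0) (𝓝 p))
    (huq : Tendsto (fun r => Splus (-u) y r) (𝓝[>] 0) (𝓝 q)) : p ≤ q := by
  by_contra! hqp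
  have hp0 : 0 < p := hq.trans_lt hqp
  obtain ⟨R, hR, hRU⟩ := nhds_basis_closedBall.mem_iff.1 (hUo.mem_nhds hy)
  obtain ⟨C, hC, hKC⟩ : ∃ C, 0 < C ∧ K < C := ⟨max K 0 + 1, by positivity, by
    linarith [le_max_left K 0]⟩
  have hpq : 0 < p - q := sub_pos.2 hqp
  obtain ⟨N, hN⟩ : ∃ N, N = (p + q + 1) / (p - q) := ⟨_, rfl⟩
  have hN1 : 1 ≤ N := by rw [hN, le_div_iff₀ hpq]; linarith
  have hNe : N * (p - q) = p + q + 1 := by rw [hN]; field_simp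
  obtain ⟨δ, hδ⟩ : ∃ δ, δ = min (1 / (2 * N + 3)) (p / 2) := ⟨_, rfl⟩
  have hδ0 : 0 < δ := by rw [hδ]; positivity
  have hδ1 : δ * (2 * N + 3) ≤ 1 := by
    rw [← le_div_iff₀ (by linarith), hδ]; exact min_le_left _ _
  have hδ2 : δ ≤ p / 2 := hδ ▸ min_le_right _ _
  have e1 := hup.eventually (Ioo_mem_nhds (a := p - δ) (b := p + δ) (by linarith) (by linarith))
  have e2 := huq.eventually_lt_const (show q < q + δ by linarith)
  obtain ⟨R₁, hR₁, hR₁'⟩ := mem_nhdsGT_iff_exists_Ioo_subset.1 (e1.and e2)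
  rw [mem_Ioi] at hR₁
  have hc' : ContinuousOn (-u) U := hc.neg
  obtain ⟨r, hr, hrR, hrR₁, hra, hrδ⟩ : ∃ r, 0 < r ∧ (N + 1) * r < R ∧ (N + 1) * r < R₁ ∧
      C * (N * r) < p - δ ∧ C / 2 * N ^ 2 * r < δ := by
    have key : ∀ c d : ℝ, 0 < d → ∀ᶠ r in 𝓝[>] (0 : ℝ), c * r < d := fun c d hd => by
      have : Tendsto (fun r : ℝ => c * r) (𝓝 0) (𝓝 (c * 0)) := tendsto_id.const_mul c
      rw [mul_zero] at this
      exact (this.mono_left nhdsWithin_le_nhds).eventually (Iio_mem_nhds hd)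
    obtain ⟨r, h0, h1, h2, h3, h4⟩ := ((eventually_mem_nhdsWithin (a := (0 : ℝ)) (s := Ioi 0)).and
      ((key (N + 1) R hR).and ((key (N + 1) R₁ hR₁).and ((key (C * N) (p - δ) (by linarith)).and
        (key (C / 2 * N ^ 2) δ hδ0))))).exists
    exact ⟨r, h0, h1, h2, by linarith, h4⟩
  have hrN : r ≤ N * r := le_mul_of_one_le_left hr.le hN1
  obtain ⟨⟨hS1, hS2⟩, -⟩ := hR₁' (show r ∈ Ioo 0 R₁ from ⟨hr, by linarith⟩)
  obtain ⟨x, hx, hxe, -⟩ := exists_mem_sphere_eq_Splus hn hc hr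
    ((closedBall_subset_closedBall (by linarith)).trans hRU)
  rw [mem_sphere] at hx
  have hxU : closedBall x (N * r) ⊆ U :=
    (closedBall_subset_closedBall' (by rw [hx]; linarith)).trans hRU
  have hyx : ‖y - x‖ = r := by rw [← dist_eq_norm, dist_comm, hx]
  obtain ⟨w, hw, hwlt⟩ : ∃ w ∈ sphere x (N * r),
      (-u) x + (p - δ) * (N * r) - C / 2 * (N * r) ^ 2 < (-u) w := by
    by_contra! hle
    have h := hu'.le_quadratic_cone hc' hC hKC (by positivity) hxU hra hle y
      (mem_closedBall_iff_norm.2 (hyx.trans_le hrN))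
    rw [hyx, Pi.neg_apply, Pi.neg_apply, hxe] at h
    nlinarith [mul_lt_mul_of_pos_right hS1 hr, mul_pos hC (pow_pos hr 2)]
  have hwy : dist w y ≤ (N + 1) * r := by
    have := dist_triangle w x y
    rw [mem_sphere.1 hw, hx] at this
    linarith
  have hwle : (-u) w ≤ (-u) y + (q + δ) * ((N + 1) * r) := by
    rcases eq_or_ne w y with rfl | hne
    · have : 0 ≤ (q + δ) * ((N + 1) * r) := by positivity
      linarith
    · have hd : 0 < dist w y := dist_pos.2 hne
      obtain ⟨-, hS⟩ := hR₁' (show dist w y ∈ Ioo 0 R₁ from ⟨hd, by linarith⟩)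
      obtain ⟨-, -, -, hm⟩ := exists_mem_sphere_eq_Splus hn hc' hd
        ((closedBall_subset_closedBall (by linarith)).trans hRU)
      have h1 := hm w (mem_sphere.2 rfl)
      have h2 : Splus (-u) y (dist w y) * dist w y ≤ (q + δ) * dist w y :=
        mul_le_mul_of_nonneg_right (le_of_lt hS) hd.le
      have h3 : (q + δ) * dist w y ≤ (q + δ) * ((N + 1) * r) := by gcongr
      linarith
  simp only [Pi.neg_apply] at hwle hwlt
  have h1 : Splus u y r * r < (p + δ) * r := mul_lt_mul_of_pos_right hS2 hr
  have h2 : C / 2 * N ^ 2 * r * r < δ * r := mul_lt_mul_of_pos_right hrδ hr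
  have h3 : ((p - δ) * N - δ) * r < ((q + δ) * (N + 1) + (p + δ)) * r := by nlinarith
  have h4 := lt_of_mul_lt_mul_right h3 hr.le
  nlinarith

end Slopes

theorem secondDeriv_neg {n : ℕ} (φ : EuclideanSpace ℝ (Fin n) → ℝ)
    (x v : EuclideanSpace ℝ (Fin n)) : secondDeriv (-φ) x v = -secondDeriv φ x v := by
  simp [secondDeriv, iteratedFDeriv_neg]

theorem laplInfMinus_neg {n : ℕ} (φ : EuclideanSpace ℝ (Fin n) → ℝ)
    (x : EuclideanSpace ℝ (Fin n)) : laplInfMinus (-φ) x = -laplInfPlus φ x := by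
  have hg : gradient (-φ) x = -gradient φ x := by
    simp [gradient, fderiv_neg]
  have hs : secondDeriv φ x (-gradient φ x) = secondDeriv φ x (gradient φ x) := by
    simp [secondDeriv, iteratedFDeriv_two_apply]
  simp only [laplInfMinus, laplInfPlus, hg, neg_eq_zero]
  split_ifs with h
  · rw [Real.sInf_def]
    congr 2
    ext t
    simp [secondDeriv_neg, neg_eq_iff_eq_neg]
  · rw [secondDeriv_neg, hs, norm_neg, neg_div]

theorem SubPair.infLaplGE {n : ℕ} {U : Set (EuclideanSpace ℝ (Fin n))}
    {u v : EuclideanSpace ℝ (Fin n) → ℝ} {K : ℝ} (h : SubPair U u v)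
    (hK : ∀ x ∈ U, |u x - v x| ≤ K) : InfLaplGE U u K := fun φ hφ x hx hm => by
  have := h φ hφ x hx hm
  linarith [(abs_le.1 (hK x hx)).1]

theorem SuperPair.infLaplGE_neg {n : ℕ} {U : Set (EuclideanSpace ℝ (Fin n))}
    {u v : EuclideanSpace ℝ (Fin n) → ℝ} {K : ℝ} (h : SuperPair U u v)
    (hK : ∀ x ∈ U, |u x - v x| ≤ K) : InfLaplGE U (-u) K := fun φ hφ x hx hm => by
  have h1 := h (-φ) hφ.neg x hx (by
    have := hm.neg
    simpa [sub_eq_add_neg, add_comm] using this)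
  rw [laplInfMinus_neg] at h1
  linarith [(abs_le.1 (hK x hx)).2]

theorem exists_slope_limits {n : ℕ} (hn : 1 ≤ n) {U : Set (EuclideanSpace ℝ (Fin n))}
    (hUo : IsOpen U) {u v : EuclideanSpace ℝ (Fin n) → ℝ} {K : ℝ} (hc : ContinuousOn u U)
    (hsub : SubPair U u v) (hsup : SuperPair U u v) (hK : ∀ x ∈ U, |u x - v x| ≤ K)
    {y : EuclideanSpace ℝ (Fin n)} (hy : y ∈ U) :
    ∃ Sp Sm : ℝ, Tendsto (fun r => Splus u y r) (𝓝[>] (0:ℝ)) (𝓝 Sp) ∧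
      Tendsto (fun r => Sminus u y r) (𝓝[>] (0:ℝ)) (𝓝 Sm) ∧ Sp = -Sm := by
  have h := hsub.infLaplGE hK
  have h' := hsup.infLaplGE_neg hK
  obtain ⟨p, hp, hpt⟩ := h.exists_tendsto_Splus hn hUo hc hy
  obtain ⟨q, hq, hqt⟩ := h'.exists_tendsto_Splus hn hUo hc.neg hy
  refine ⟨p, -q, hpt, ?_, ?_⟩
  · simpa only [Sminus_eq_neg_Splus_neg] using hqt.neg
  · rw [neg_neg]
    exact le_antisymm (h'.slope_le_slope_neg hn hUo hc hy hq hpt hqt)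
      (InfLaplGE.slope_le_slope_neg (u := -u) (by rwa [neg_neg]) hn hUo hc.neg hy hp hqt
        (by rwa [neg_neg]))

/-- Lemma 5.6(ii): `S_i⁺(y)` and `S_i⁻(y)` exist and `S_i⁺(y) = −S_i⁻(y)`. -/
theorem slope_limits_opposite {n : ℕ} (hn : 1 ≤ n)
    {U : Set (EuclideanSpace ℝ (Fin n))} (hUo : IsOpen U) (hUb : Bornology.IsBounded U)
    {u₁ u₂ : EuclideanSpace ℝ (Fin n) → ℝ}
    (hu₁ : ContinuousOn u₁ (closure U)) (hu₂ : ContinuousOn u₂ (closure U))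
    (hsol : IsSolution U u₁ u₂) :
    ∀ y ∈ U,
      (∃ Sp Sm : ℝ, Tendsto (fun r => Splus u₁ y r) (𝓝[>] (0:ℝ)) (𝓝 Sp) ∧
        Tendsto (fun r => Sminus u₁ y r) (𝓝[>] (0:ℝ)) (𝓝 Sm) ∧ Sp = -Sm) ∧
      (∃ Sp Sm : ℝ, Tendsto (fun r => Splus u₂ y r) (𝓝[>] (0:ℝ)) (𝓝 Sp) ∧
        Tendsto (fun r => Sminus u₂ y r) (𝓝[>] (0:ℝ)) (𝓝 Sm) ∧ Sp = -Sm) := by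
  obtain ⟨K, hK⟩ := (hUb.isCompact_closure).exists_bound_of_continuousOn (hu₁.sub hu₂)
  have hK₁ : ∀ x ∈ U, |u₁ x - u₂ x| ≤ K := fun x hx => hK x (subset_closure hx)
  have hK₂ : ∀ x ∈ U, |u₂ x - u₁ x| ≤ K := fun x hx => abs_sub_comm (u₁ x) _ ▸ hK₁ x hx
  obtain ⟨⟨-, -, hsub₁, hsub₂⟩, -, -, hsup₁, hsup₂⟩ := hsol
  exact fun y hy => ⟨exists_slope_limits hn hUo (hu₁.mono subset_closure) hsub₁ hsup₁ hK₁ hy,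
    exists_slope_limits hn hUo (hu₂.mono subset_closure) hsub₂ hsup₂ hK₂ hy⟩
end

section
/- Entire smooth solution (Remark 4.2). Let n ≥ 1 and x₀ ∈ ℝⁿ. Define u₁(x) := e^{√2|x−x₀|} + e^{−√2|x−x₀|} and u₂(x) := −u₁(x) for x ∈ ℝⁿ. Then u₁ and u₂ are C^∞ (in particular C², hence differentiable everywhere, including at x₀) on all of ℝⁿ, and (u₁, u₂) is a viscosity solution of the system −Δ∞u₁ + u₁ − u₂ = 0, −Δ∞u₂ + u₂ − u₁ = 0 in the whole space ℝⁿ. -/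
open Filter Metric Set Topology

open scoped Nat in
/-- `cosh x` is an analytic function of `x ^ 2`. -/
theorem Real.exists_contDiff_cosh_eq_comp_sq :
    ∃ G : ℝ → ℝ, ContDiff ℝ (⊤ : ℕ∞) G ∧ ∀ x, Real.cosh x = G (x ^ 2) := by
  let c : ℕ → ℝ := fun k => ((2 * k)! : ℝ)⁻¹
  have hr : (FormalMultilinearSeries.ofScalars ℝ c).radius = ⊤ := by
    refine FormalMultilinearSeries.ofScalars_radius_eq_top_of_tendsto ℝ c
      (Eventually.of_forall fun k => by positivity) ?_
    refine squeeze_zero (fun _ => by positivity) (fun k => ?_)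
      (tendsto_one_div_add_atTop_nhds_zero_nat (𝕜 := ℝ))
    have h : ((2 * k.succ)! : ℝ) = (2 * k + 2) * (2 * k + 1) * (2 * k)! := by
      rw [show 2 * k.succ = 2 * k + 1 + 1 by omega, Nat.factorial_succ, Nat.factorial_succ]
      push_cast
      ring
    have hk : (0 : ℝ) < (2 * k)! := by positivity
    simp only [c, norm_inv, h, Real.norm_eq_abs, abs_mul, abs_of_pos hk]
    rw [abs_of_nonneg (by positivity), abs_of_nonneg (by positivity)]
    field_simp
    nlinarith
  refine ⟨FormalMultilinearSeries.ofScalarsSum c, ?_, fun x => ?_⟩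
  · have h := (FormalMultilinearSeries.ofScalars ℝ c).hasFPowerSeriesOnBall (by simp [hr])
    refine AnalyticOnNhd.contDiff fun x _ => h.analyticAt_of_mem ?_
    simp [hr]
  · rw [FormalMultilinearSeries.ofScalars_sum_eq, Real.cosh_eq_tsum]
    refine tsum_congr fun k => ?_
    simp only [c, smul_eq_mul, pow_mul]
    ring

/-- At a local minimum the second derivative is nonnegative. -/
theorem IsLocalMin.deriv_deriv_nonneg {f : ℝ → ℝ} {a : ℝ} (h : IsLocalMin f a)
    (hc : ContinuousAt f a) : 0 ≤ deriv (deriv f) a := by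
  by_contra! hneg
  have hmax := isLocalMax_of_deriv_deriv_neg hneg h.deriv_eq_zero hc
  have heq : f =ᶠ[𝓝 a] fun _ => f a := by
    filter_upwards [h, hmax] with y h₁ h₂ using le_antisymm h₂ h₁
  have : deriv (deriv f) a = 0 := by
    rw [heq.deriv.deriv_eq]
    simp
  exact hneg.ne this

section SecondDeriv

variable {n : ℕ} {f g : EuclideanSpace ℝ (Fin n) → ℝ} {x e : EuclideanSpace ℝ (Fin n)}

/-- The second directional derivative is the second derivative along a line. -/
theorem secondDeriv_eq_deriv_deriv (hf : ContDiff ℝ 2 f) (x v : EuclideanSpace ℝ (Fin n)) :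
    secondDeriv f x v = deriv (deriv fun t : ℝ => f (x + t • v)) 0 := by
  have hl : ∀ t : ℝ, HasDerivAt (fun t : ℝ => x + t • v) v t := fun t => by
    simpa using ((hasDerivAt_id t).smul_const v).const_add x
  have h₁ : (deriv fun t : ℝ => f (x + t • v)) = fun t => fderiv ℝ f (x + t • v) v := by
    funext t
    exact (((hf.differentiable (by norm_num)) _).hasFDerivAt.comp_hasDerivAt t (hl t)).deriv
  have hd : Differentiable ℝ (fderiv ℝ f) :=
    (hf.fderiv_right (m := 1) (by norm_num)).differentiable (by norm_num)
  have h₂ : HasDerivAt (fun t : ℝ => fderiv ℝ f (x + t • v)) (fderiv ℝ (fderiv ℝ f) x v) 0 := by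
    refine HasFDerivAt.comp_hasDerivAt (0 : ℝ) ?_ (hl 0)
    simpa using (hd x).hasFDerivAt
  have h₃ := h₂.clm_apply (hasDerivAt_const (0 : ℝ) v)
  rw [h₁, secondDeriv, iteratedFDeriv_two_apply, h₃.deriv]
  simp

theorem secondDeriv_smul (f : EuclideanSpace ℝ (Fin n) → ℝ) (x v : EuclideanSpace ℝ (Fin n))
    (c : ℝ) : secondDeriv f x (c • v) = c ^ 2 * secondDeriv f x v := by
  simp only [secondDeriv, iteratedFDeriv_two_apply]
  simp
  ring

theorem abs_secondDeriv_le (f : EuclideanSpace ℝ (Fin n) → ℝ) (x : EuclideanSpace ℝ (Fin n))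
    {v : EuclideanSpace ℝ (Fin n)} (hv : ‖v‖ = 1) :
    |secondDeriv f x v| ≤ ‖iteratedFDeriv ℝ 2 f x‖ := by
  simpa [secondDeriv, Fin.prod_univ_two, hv] using
    (iteratedFDeriv ℝ 2 f x).le_opNorm ![v, v]

theorem secondDeriv_le_laplInfPlus (he : ‖e‖ = 1) {c : ℝ} (hg : gradient f x = c • e) :
    secondDeriv f x e ≤ laplInfPlus f x := by
  rw [laplInfPlus]
  split_ifs with h
  · refine le_csSup ⟨‖iteratedFDeriv ℝ 2 f x‖, ?_⟩ ⟨e, he, rfl⟩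
    rintro t ⟨v, hv, rfl⟩
    exact (abs_le.1 (abs_secondDeriv_le f x hv)).2
  · have hc : c ≠ 0 := by
      rintro rfl
      simp [hg] at h
    rw [hg, secondDeriv_smul, norm_smul, he, mul_one, Real.norm_eq_abs, sq_abs,
      mul_div_cancel_left₀ _ (pow_ne_zero 2 hc)]

theorem laplInfMinus_le_secondDeriv (he : ‖e‖ = 1) {c : ℝ} (hg : gradient f x = c • e) :
    laplInfMinus f x ≤ secondDeriv f x e := by
  rw [laplInfMinus]
  split_ifs with h
  · refine csInf_le ⟨-‖iteratedFDeriv ℝ 2 f x‖, ?_⟩ ⟨e, he, rfl⟩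
    rintro t ⟨v, hv, rfl⟩
    exact (abs_le.1 (abs_secondDeriv_le f x hv)).1
  · have hc : c ≠ 0 := by
      rintro rfl
      simp [hg] at h
    rw [hg, secondDeriv_smul, norm_smul, he, mul_one, Real.norm_eq_abs, sq_abs,
      mul_div_cancel_left₀ _ (pow_ne_zero 2 hc)]

theorem IsLocalMin.gradient_eq (hf : ContDiff ℝ 2 f) (hg : ContDiff ℝ 2 g)
    (h : IsLocalMin (fun y => f y - g y) x) : gradient f x = gradient g x := by
  have := h.fderiv_eq_zero
  rw [fderiv_fun_sub (hf.differentiable (by norm_num) x) (hg.differentiable (by norm_num) x),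
    sub_eq_zero] at this
  rw [gradient, gradient, this]

theorem IsLocalMin.secondDeriv_le (hf : ContDiff ℝ 2 f) (hg : ContDiff ℝ 2 g)
    (h : IsLocalMin (fun y => f y - g y) x) (v : EuclideanSpace ℝ (Fin n)) :
    secondDeriv g x v ≤ secondDeriv f x v := by
  have hs : secondDeriv (fun y => f y - g y) x v = secondDeriv f x v - secondDeriv g x v := by
    rw [secondDeriv, fun_iteratedFDeriv_sub_apply hf.contDiffAt hg.contDiffAt]
    rfl
  have hl : Continuous fun t : ℝ => x + t • v := by fun_prop
  have hm : IsLocalMin (fun t : ℝ => f (x + t • v) - g (x + t • v)) 0 := by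
    refine IsLocalMin.comp_continuous (f := fun y => f y - g y) (g := fun t : ℝ => x + t • v)
      ?_ hl.continuousAt
    simpa using h
  have h₀ := hm.deriv_deriv_nonneg
    ((hf.continuous.comp hl).sub (hg.continuous.comp hl)).continuousAt
  rw [← secondDeriv_eq_deriv_deriv (hf.sub hg), hs] at h₀
  linarith

end SecondDeriv

section Classical

variable {n : ℕ} {u v : EuclideanSpace ℝ (Fin n) → ℝ}

theorem SubPair.of_contDiff (hu : ContDiff ℝ 2 u)
    (h : ∀ x, ∃ e : EuclideanSpace ℝ (Fin n), ‖e‖ = 1 ∧ (∃ c : ℝ, gradient u x = c • e) ∧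
      secondDeriv u x e = u x - v x) : SubPair univ u v := by
  intro φ hφ x _ hx
  obtain ⟨e, he, ⟨c, hc⟩, hs⟩ := h x
  have hmin : IsLocalMin (fun y => φ y - u y) x := by
    simpa using (isLocalMaxOn_univ_iff.1 hx).neg
  have h₁ := hmin.secondDeriv_le hφ hu e
  have h₂ := secondDeriv_le_laplInfPlus he ((hmin.gradient_eq hφ hu).trans hc)
  linarith

theorem SuperPair.of_contDiff (hu : ContDiff ℝ 2 u)
    (h : ∀ x, ∃ e : EuclideanSpace ℝ (Fin n), ‖e‖ = 1 ∧ (∃ c : ℝ, gradient u x = c • e) ∧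
      secondDeriv u x e = u x - v x) : SuperPair univ u v := by
  intro φ hφ x _ hx
  obtain ⟨e, he, ⟨c, hc⟩, hs⟩ := h x
  have hmin : IsLocalMin (fun y => u y - φ y) x := isLocalMinOn_univ_iff.1 hx
  have h₁ := hmin.secondDeriv_le hu hφ e
  have h₂ := laplInfMinus_le_secondDeriv he ((hmin.gradient_eq hu hφ).symm.trans hc)
  linarith

end Classical

section RadialCosh

variable {n : ℕ}

theorem exists_norm_eq_one_eq_add_smul (hn : 1 ≤ n) (x₀ x : EuclideanSpace ℝ (Fin n)) :
    ∃ (e : EuclideanSpace ℝ (Fin n)) (r : ℝ), ‖e‖ = 1 ∧ x = x₀ + r • e := by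
  rcases eq_or_ne x x₀ with rfl | hx
  · exact ⟨EuclideanSpace.single ⟨0, hn⟩ 1, 0, by simp, by simp⟩
  · have h : ‖x - x₀‖ ≠ 0 := norm_ne_zero_iff.2 (sub_ne_zero.2 hx)
    exact ⟨‖x - x₀‖⁻¹ • (x - x₀), ‖x - x₀‖, by simp [norm_smul, h], by simp [smul_smul, h]⟩

theorem contDiff_cosh_norm_sub (a : ℝ) (x₀ : EuclideanSpace ℝ (Fin n)) :
    ContDiff ℝ (⊤ : ℕ∞) fun x => Real.cosh (a * ‖x - x₀‖) := by
  obtain ⟨G, hG, hcosh⟩ := Real.exists_contDiff_cosh_eq_comp_sq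
  simp only [hcosh, mul_pow]
  exact hG.comp (contDiff_const.mul ((contDiff_id.sub contDiff_const).norm_sq ℝ))

theorem exists_gradient_cosh_norm_sub (a b : ℝ) (x₀ x : EuclideanSpace ℝ (Fin n)) :
    ∃ c : ℝ, gradient (fun y => b * Real.cosh (a * ‖y - x₀‖)) x = c • (x - x₀) := by
  obtain ⟨G, hG, hcosh⟩ := Real.exists_contDiff_cosh_eq_comp_sq
  simp only [hcosh, mul_pow]
  have h₁ := ((hasFDerivAt_id x).sub_const x₀).norm_sq.const_mul (a ^ 2)
  have h₂ := ((hG.differentiable (by simp) _).hasDerivAt.comp_hasFDerivAt x h₁).const_mul b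
  refine ⟨b * (deriv G (a ^ 2 * ‖x - x₀‖ ^ 2) * (a ^ 2 * 2)), HasGradientAt.gradient ?_⟩
  rw [hasGradientAt_iff_hasFDerivAt]
  refine h₂.congr_fderiv ?_
  ext w
  simp
  ring

theorem secondDeriv_cosh_norm_sub (a b r : ℝ) (x₀ : EuclideanSpace ℝ (Fin n))
    {e : EuclideanSpace ℝ (Fin n)} (he : ‖e‖ = 1) :
    secondDeriv (fun y => b * Real.cosh (a * ‖y - x₀‖)) (x₀ + r • e) e =
      a ^ 2 * (b * Real.cosh (a * ‖x₀ + r • e - x₀‖)) := by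
  have hline : ∀ t : ℝ,
      Real.cosh (a * ‖x₀ + r • e + t • e - x₀‖) = Real.cosh (a * (r + t)) := fun t => by
    rw [add_assoc, add_sub_cancel_left, ← add_smul, norm_smul, he, mul_one, Real.norm_eq_abs,
      ← Real.cosh_abs, abs_mul, abs_abs, ← abs_mul, Real.cosh_abs]
  have harg : ∀ t : ℝ, HasDerivAt (fun t : ℝ => a * (r + t)) a t := fun t => by
    simpa using ((hasDerivAt_id t).const_add r).const_mul a
  have h₁ : (deriv fun t : ℝ => b * Real.cosh (a * (r + t))) =
      fun t => b * (Real.sinh (a * (r + t)) * a) :=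
    funext fun t => ((harg t).cosh.const_mul b).deriv
  have h₂ := (((harg 0).sinh.mul_const a).const_mul b).deriv
  rw [secondDeriv_eq_deriv_deriv
    ((contDiff_const.mul (contDiff_cosh_norm_sub a x₀)).of_le (WithTop.coe_le_coe.2 le_top))]
  have h₃ := hline 0
  rw [zero_smul, add_zero] at h₃
  simp only [hline, h₁, h₂, h₃]
  ring

theorem exists_direction_secondDeriv_cosh (hn : 1 ≤ n) (a b : ℝ)
    (x₀ x : EuclideanSpace ℝ (Fin n)) :
    ∃ e : EuclideanSpace ℝ (Fin n), ‖e‖ = 1 ∧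
      (∃ c : ℝ, gradient (fun y => b * Real.cosh (a * ‖y - x₀‖)) x = c • e) ∧
      secondDeriv (fun y => b * Real.cosh (a * ‖y - x₀‖)) x e =
        a ^ 2 * (b * Real.cosh (a * ‖x - x₀‖)) := by
  obtain ⟨e, r, he, rfl⟩ := exists_norm_eq_one_eq_add_smul hn x₀ x
  obtain ⟨c, hc⟩ := exists_gradient_cosh_norm_sub a b x₀ (x₀ + r • e)
  refine ⟨e, he, ⟨c * r, ?_⟩, secondDeriv_cosh_norm_sub a b r x₀ he⟩
  rw [hc, add_sub_cancel_left, smul_smul]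

end RadialCosh

/-- Entire smooth solution (Remark 4.2): `(e^{√2|x−x₀|} + e^{−√2|x−x₀|}, −(⋯))`
is a smooth viscosity solution of the system in all of `ℝⁿ`. -/
theorem entire_smooth_solution {n : ℕ} (hn : 1 ≤ n) (x₀ : EuclideanSpace ℝ (Fin n))
    (u₁ u₂ : EuclideanSpace ℝ (Fin n) → ℝ)
    (hu₁ : ∀ x, u₁ x = Real.exp (Real.sqrt 2 * ‖x - x₀‖) +
      Real.exp (-(Real.sqrt 2 * ‖x - x₀‖)))
    (hu₂ : ∀ x, u₂ x = -u₁ x) :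
    ContDiff ℝ (⊤ : ℕ∞) u₁ ∧ ContDiff ℝ (⊤ : ℕ∞) u₂ ∧
      IsSolution (Set.univ : Set (EuclideanSpace ℝ (Fin n))) u₁ u₂ := by
  have h₁ : u₁ = fun y => 2 * Real.cosh (√2 * ‖y - x₀‖) := by
    funext y
    rw [hu₁, Real.cosh_eq]
    ring
  have h₂ : u₂ = fun y => -2 * Real.cosh (√2 * ‖y - x₀‖) := by
    funext y
    rw [hu₂, h₁]
    ring
  have hs₁ : ContDiff ℝ (⊤ : ℕ∞) u₁ := h₁ ▸ contDiff_const.mul (contDiff_cosh_norm_sub _ x₀)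
  have hs₂ : ContDiff ℝ (⊤ : ℕ∞) u₂ := h₂ ▸ contDiff_const.mul (contDiff_cosh_norm_sub _ x₀)
  have hc₁ : ContDiff ℝ 2 u₁ := hs₁.of_le (WithTop.coe_le_coe.2 le_top)
  have hc₂ : ContDiff ℝ 2 u₂ := hs₂.of_le (WithTop.coe_le_coe.2 le_top)
  have he₁ : ∀ x, ∃ e : EuclideanSpace ℝ (Fin n), ‖e‖ = 1 ∧
      (∃ c : ℝ, gradient u₁ x = c • e) ∧ secondDeriv u₁ x e = u₁ x - u₂ x := fun x => by
    obtain ⟨e, he, hg, hd⟩ := exists_direction_secondDeriv_cosh hn (√2) 2 x₀ x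
    rw [← h₁] at hg hd
    refine ⟨e, he, hg, hd.trans ?_⟩
    rw [Real.sq_sqrt zero_le_two, h₁, h₂]
    ring
  have he₂ : ∀ x, ∃ e : EuclideanSpace ℝ (Fin n), ‖e‖ = 1 ∧
      (∃ c : ℝ, gradient u₂ x = c • e) ∧ secondDeriv u₂ x e = u₂ x - u₁ x := fun x => by
    obtain ⟨e, he, hg, hd⟩ := exists_direction_secondDeriv_cosh hn (√2) (-2) x₀ x
    rw [← h₂] at hg hd
    refine ⟨e, he, hg, hd.trans ?_⟩
    rw [Real.sq_sqrt zero_le_two, h₁, h₂]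
    ring
  exact ⟨hs₁, hs₂,
    ⟨hc₁.continuous.continuousOn.upperSemicontinuousOn,
      hc₂.continuous.continuousOn.upperSemicontinuousOn, .of_contDiff hc₁ he₁,
      .of_contDiff hc₂ he₂⟩,
    ⟨hc₁.continuous.continuousOn.lowerSemicontinuousOn,
      hc₂.continuous.continuousOn.lowerSemicontinuousOn, .of_contDiff hc₁ he₁,
      .of_contDiff hc₂ he₂⟩⟩
end

section
/- Monotonicity failure for systems (Example 5.1). Define F : (0, ∞) → ℝ by F(s) := −(e^{√2 s} + e^{−√2 s})/(e^{√2} + e^{−√2}) and G : (0, ∞) → ℝ by G(s) := (F(s) − F(0⁺))/s = −(e^{√2 s} + e^{−√2 s} − 2)/((e^{√2} + e^{−√2})·s). Then F is strictly decreasing on (0, ∞) (so for 0 < s < r < 1 one has F(r) < F(s)), and G is strictly decreasing on (0, ∞). (Here F(s) = M₁(0,s) and G(s) = S₁⁺(0,s) for the explicit solution v₁(x) = −(e^{√2|x|} + e^{−√2|x|})/(e^{√2} + e^{−√2}), v₂ = −v₁ of the system on the unit ball with boundary data g₁ ≡ −1, g₂ ≡ 1, exhibiting that the maximum M₁ on spheres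 and the slope S₁⁺ need not be nondecreasing in the radius, unlike the single infinity Laplace equation.) -/
/-- Strict convexity of the exponential on the segment from `0` to `y`. -/
theorem Real.exp_mul_lt_of_mem_Ioo {t y : ℝ} (ht : t ∈ Set.Ioo (0 : ℝ) 1) (hy : y ≠ 0) :
    Real.exp (t * y) < (1 - t) + t * Real.exp y := by
  simpa using strictConvexOn_exp.2 (Set.mem_univ 0) (Set.mem_univ y) hy.symm
    (sub_pos.2 ht.2) ht.1 (sub_add_cancel 1 t)

theorem strictMonoOn_exp_add_exp_neg_mul {a : ℝ} (ha : 0 < a) :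
    StrictMonoOn (fun s : ℝ => Real.exp (a * s) + Real.exp (-(a * s))) (Set.Ioi 0) := by
  intro s hs r hr hsr
  rw [Set.mem_Ioi] at hs hr
  have h : Real.cosh (a * s) < Real.cosh (a * r) := by
    rw [Real.cosh_lt_cosh, abs_of_pos (by positivity), abs_of_pos (by positivity)]
    gcongr
  rw [Real.cosh_eq, Real.cosh_eq] at h
  dsimp only
  linarith

theorem strictMonoOn_exp_add_exp_neg_mul_sub_two_div {a : ℝ} (ha : 0 < a) :
    StrictMonoOn (fun s : ℝ => (Real.exp (a * s) + Real.exp (-(a * s)) - 2) / s)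
      (Set.Ioi 0) := by
  intro s hs r hr hsr
  rw [Set.mem_Ioi] at hs hr
  have ht : s / r ∈ Set.Ioo (0 : ℝ) 1 := ⟨by positivity, (div_lt_one hr).2 hsr⟩
  have har : a * r ≠ 0 := by positivity
  have h₁ := Real.exp_mul_lt_of_mem_Ioo ht har
  have h₂ := Real.exp_mul_lt_of_mem_Ioo ht (neg_ne_zero.2 har)
  have e : s / r * (a * r) = a * s := by field_simp
  rw [mul_neg] at h₂
  rw [e] at h₁ h₂
  dsimp only
  rw [div_lt_iff₀ hs, div_mul_eq_mul_div, mul_div_assoc]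
  linarith

/-- Example 5.1: for the explicit solution on the unit ball, both
`F(s) = M₁(0,s)` and `G(s) = S₁⁺(0,s)` are strictly decreasing on `(0, ∞)`,
exhibiting the failure of the single-equation monotonicity for systems. -/
theorem monotonicity_failure_example :
    StrictAntiOn (fun s : ℝ =>
      -((Real.exp (Real.sqrt 2 * s) + Real.exp (-(Real.sqrt 2 * s))) /
        (Real.exp (Real.sqrt 2) + Real.exp (-(Real.sqrt 2))))) (Set.Ioi (0:ℝ)) ∧
    StrictAntiOn (fun s : ℝ =>
      -((Real.exp (Real.sqrt 2 * s) + Real.exp (-(Real.sqrt 2 * s)) - 2) /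
        ((Real.exp (Real.sqrt 2) + Real.exp (-(Real.sqrt 2))) * s))) (Set.Ioi (0:ℝ)) := by
  have ha : 0 < Real.sqrt 2 := by positivity
  constructor
  · intro s hs r hr hsr
    have h := strictMonoOn_exp_add_exp_neg_mul ha hs hr hsr
    dsimp only at h ⊢
    gcongr
  · intro s hs r hr hsr
    have h := strictMonoOn_exp_add_exp_neg_mul_sub_two_div ha hs hr hsr
    dsimp only at h ⊢
    rw [neg_lt_neg_iff, div_mul_eq_div_div_swap, div_mul_eq_div_div_swap]
    gcongr
end
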